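/- arXiv:0803.0998 — 2 statements merged into one kernel-verified Lean document; each statement's English description precedes it below -/
import Mathlib

section
/- Let R be a commutative noetherian ring of finite Krull dimension and C a semidualizing R-module. If M is a G_C-flat R-module, then there exists a short exact sequence 0 → K → X → M → 0 of R-modules in which K is C-flat and X is G_C-projective. -/
open CategoryTheory TensorProduct

universe u

section
variable (R : Type u) [CommRing R]

def extZero (M N : ModuleCat.{u} R) : Prop :=
  ∀ i : ℕ, 1 ≤ i → Subsingleton (((Ext R (ModuleCat.{u} R) i).obj (Opposite.op M)).obj N)

def torZero (M N : ModuleCat.{u} R) : Prop :=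
  ∀ i : ℕ, 1 ≤ i → Subsingleton (((Tor (ModuleCat.{u} R) i).obj M).obj N)

def IsSemidualizing (C : ModuleCat.{u} R) : Prop :=
  Module.Finite R C ∧ Function.Bijective (LinearMap.lsmul R C) ∧ extZero R C C

/-- A module is `C`-flat if it is isomorphic to `F ⊗[R] C` with `F` flat. -/
def IsCFlat (C M : ModuleCat.{u} R) : Prop :=
  ∃ F : ModuleCat.{u} R, Module.Flat R F ∧ Nonempty (M ≃ₗ[R] (F ⊗[R] C))

def IsCInjective (C M : ModuleCat.{u} R) : Prop :=
  ∃ I : ModuleCat.{u} R, Module.Injective R I ∧ Nonempty (M ≃ₗ[R] (↥C →ₗ[R] ↥I))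

/-- cotorsion: `Ext^{≥1}(F, N) = 0` for all flat `F`. -/
def IsCotorsion (N : ModuleCat.{u} R) : Prop :=
  ∀ F : ModuleCat.{u} R, Module.Flat R F → extZero R F N

/-- `C`-cotorsion: `Ext^{≥1}(F ⊗ C, N) = 0` for all flat `F`. -/
def IsCCotorsion (C N : ModuleCat.{u} R) : Prop :=
  ∀ F : ModuleCat.{u} R, Module.Flat R F →
    extZero R (ModuleCat.of R (↥F ⊗[R] ↥C)) N

/-- `C`-flat `C`-cotorsion: isomorphic to `F ⊗ C` with `F` flat and cotorsion. -/
def IsCFlatCotorsion (C M : ModuleCat.{u} R) : Prop :=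
  ∃ F : ModuleCat.{u} R, Module.Flat R F ∧ IsCotorsion R F ∧
    Nonempty (M ≃ₗ[R] (F ⊗[R] C))

/-- The natural evaluation map `C ⊗ Hom(C,M) → M`. -/
noncomputable def evalMap (C M : ModuleCat.{u} R) :
    (↥C ⊗[R] (↥C →ₗ[R] ↥M)) →ₗ[R] ↥M :=
  TensorProduct.lift (LinearMap.id (R := R) (M := ↥C →ₗ[R] ↥M)).flip

/-- The Bass class `B_C(R)`. -/
noncomputable def InBassClass (C M : ModuleCat.{u} R) : Prop :=
  extZero R C M ∧
  torZero R C (ModuleCat.of R (↥C →ₗ[R] ↥M)) ∧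
  Function.Bijective (evalMap R C M)

/-- A `ℤ`-indexed complex of `R`-modules: `d i : X (i+1) → X i`. -/
structure ZComplex where
  X : ℤ → ModuleCat.{u} R
  d : ∀ i : ℤ, ↥(X (i + 1)) →ₗ[R] ↥(X i)
  d_comp_d : ∀ i : ℤ, (d i).comp (d (i + 1)) = 0

namespace ZComplex

variable {R} (Z : ZComplex R)

/-- Exactness of the complex. -/
def IsExact : Prop := ∀ i : ℤ, Function.Exact (Z.d (i + 1)) (Z.d i)

/-- Exactness of `Z ⊗[R] J`. -/
def TensorExact (J : ModuleCat.{u} R) : Prop :=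
  ∀ i : ℤ, Function.Exact (LinearMap.rTensor (↥J) (Z.d (i + 1)))
    (LinearMap.rTensor (↥J) (Z.d i))

/-- Exactness of `Hom_R(V, Z)`. -/
def HomFromExact (V : ModuleCat.{u} R) : Prop :=
  ∀ i : ℤ, Function.Exact
    (fun f : ↥V →ₗ[R] ↥(Z.X (i + 1 + 1)) => (Z.d (i + 1)).comp f)
    (fun f : ↥V →ₗ[R] ↥(Z.X (i + 1)) => (Z.d i).comp f)

/-- Exactness of `Hom_R(Z, V)`. -/
def HomToExact (V : ModuleCat.{u} R) : Prop :=
  ∀ i : ℤ, Function.Exact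
    (fun g : ↥(Z.X i) →ₗ[R] ↥V => g.comp (Z.d i))
    (fun g : ↥(Z.X (i + 1)) →ₗ[R] ↥V => g.comp (Z.d (i + 1)))

/-- `M ≅ Coker(∂₁)`. -/
def IsCokerOfD1 (M : ModuleCat.{u} R) : Prop :=
  Nonempty (↥M ≃ₗ[R] (↥(Z.X 0) ⧸ LinearMap.range (Z.d 0)))

end ZComplex

end

section
variable (R : Type u) [CommRing R]

/-- A complete `FF_C`-resolution witnessing that `M` is `G_C`-flat. -/
def IsGCFlat (C M : ModuleCat.{u} R) : Prop :=
  ∃ Z : ZComplex R, Z.IsExact ∧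
    (∀ i : ℤ, 0 ≤ i → Module.Flat R (Z.X i)) ∧
    (∀ i : ℤ, i < 0 → IsCFlat R C (Z.X i)) ∧
    (∀ J : ModuleCat.{u} R, IsCInjective R C J → Z.TensorExact J) ∧
    Z.IsCokerOfD1 M

def IsCProjective (C M : ModuleCat.{u} R) : Prop :=
  ∃ P : ModuleCat.{u} R, Module.Projective R P ∧ Nonempty (M ≃ₗ[R] (P ⊗[R] C))

/-- A complete `PP_C`-resolution witnessing that `M` is `G_C`-projective. -/
def IsGCProjective (C M : ModuleCat.{u} R) : Prop :=
  ∃ Z : ZComplex R, Z.IsExact ∧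
    (∀ i : ℤ, 0 ≤ i → Module.Projective R (Z.X i)) ∧
    (∀ i : ℤ, i < 0 → IsCProjective R C (Z.X i)) ∧
    (∀ Q : ModuleCat.{u} R, IsCProjective R C Q → Z.HomToExact Q) ∧
    Z.IsCokerOfD1 M

/-- `G(𝒳)` for a class `𝒳` of modules. -/
def GClass (𝒳 : ModuleCat.{u} R → Prop) (M : ModuleCat.{u} R) : Prop :=
  ∃ Z : ZComplex R, Z.IsExact ∧
    (∀ i : ℤ, 𝒳 (Z.X i)) ∧
    (∀ V : ModuleCat.{u} R, 𝒳 V → Z.HomFromExact V) ∧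
    (∀ V : ModuleCat.{u} R, 𝒳 V → Z.HomToExact V) ∧
    Z.IsCokerOfD1 M

/-- Iterates `G^n(𝒳)`, with `G^0(𝒳) = 𝒳`. -/
def GIter : ℕ → (ModuleCat.{u} R → Prop) → (ModuleCat.{u} R → Prop)
  | 0, 𝒳 => 𝒳
  | n + 1, 𝒳 => GClass R (GIter n 𝒳)

/-- `H_C(𝒳)`: modules with a `P_C F_C^cot`-complete `𝒳`-resolution. -/
def HClass (C : ModuleCat.{u} R) (𝒳 : ModuleCat.{u} R → Prop) (M : ModuleCat.{u} R) : Prop :=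
  ∃ Z : ZComplex R, Z.IsExact ∧
    (∀ i : ℤ, 𝒳 (Z.X i)) ∧
    (∀ P : ModuleCat.{u} R, Module.Projective R P →
      Z.HomFromExact (ModuleCat.of R (↥P ⊗[R] ↥C))) ∧
    (∀ N : ModuleCat.{u} R, IsCFlatCotorsion R C N → Z.HomToExact N) ∧
    Z.IsCokerOfD1 M

/-- Iterates `H_C^n(𝒳)`, with `H_C^0(𝒳) = 𝒳`. -/
def HIter (C : ModuleCat.{u} R) : ℕ → (ModuleCat.{u} R → Prop) → (ModuleCat.{u} R → Prop)
  | 0, 𝒳 => 𝒳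
  | n + 1, 𝒳 => HClass R C (HIter C n 𝒳)

/-- `M` admits a resolution `0 → X_n → ⋯ → X_0 → M → 0` with each `X_i` in `𝒳`. -/
def HasResOfLength (𝒳 : ModuleCat.{u} R → Prop) (n : ℕ) (M : ModuleCat.{u} R) : Prop :=
  ∃ (P : ℕ → ModuleCat.{u} R) (d : ∀ i : ℕ, ↥(P (i + 1)) →ₗ[R] ↥(P i))
    (ε : ↥(P 0) →ₗ[R] ↥M),
      Function.Surjective ε ∧ Function.Exact (d 0) ε ∧
      (∀ i : ℕ, Function.Exact (d (i + 1)) (d i)) ∧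
      (∀ i : ℕ, i ≤ n → 𝒳 (P i)) ∧
      (∀ i : ℕ, n < i → Subsingleton (P i))

/-- `M` admits a coresolution `0 → M → Y_0 → ⋯ → Y_n → 0` with each `Y_i` in `𝒳`. -/
def HasCoresOfLength (𝒳 : ModuleCat.{u} R → Prop) (n : ℕ) (M : ModuleCat.{u} R) : Prop :=
  ∃ (P : ℕ → ModuleCat.{u} R) (d : ∀ i : ℕ, ↥(P i) →ₗ[R] ↥(P (i + 1)))
    (η : ↥M →ₗ[R] ↥(P 0)),
      Function.Injective η ∧ Function.Exact η (d 0) ∧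
      (∀ i : ℕ, Function.Exact (d i) (d (i + 1))) ∧
      (∀ i : ℕ, i ≤ n → 𝒳 (P i)) ∧
      (∀ i : ℕ, n < i → Subsingleton (P i))

/-- `C` is a dualizing module: semidualizing of finite injective dimension. -/
def IsDualizing (C : ModuleCat.{u} R) : Prop :=
  IsSemidualizing R C ∧
  ∃ n : ℕ, HasCoresOfLength R (fun I => Module.Injective R ↥I) n C

end

section
variable {R : Type u} [CommRing R]

/-- A map into an injective module that kills `ker f` factors through `f`. -/
theorem Module.Injective.exists_comp_eq_of_ker_le {A B J : Type u} [AddCommGroup A] [Module R A]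
    [AddCommGroup B] [Module R B] [AddCommGroup J] [Module R J] (hJ : Module.Injective R J)
    (f : A →ₗ[R] B) (g : A →ₗ[R] J) (h : LinearMap.ker f ≤ LinearMap.ker g) :
    ∃ k : B →ₗ[R] J, k ∘ₗ f = g := by
  obtain ⟨k, hk⟩ := hJ.out ((LinearMap.ker f).liftQ f le_rfl)
    (LinearMap.ker_eq_bot.mp (Submodule.ker_liftQ_eq_bot _ _ _ le_rfl))
    ((LinearMap.ker f).liftQ g h)
  refine ⟨k, LinearMap.ext fun x => ?_⟩
  simpa using hk (Submodule.Quotient.mk x)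

section homEval

variable (R) {ι : Type u} (E J : ι → Type u) [∀ p, AddCommGroup (E p)] [∀ p, Module R (E p)]
  [∀ p, AddCommGroup (J p)] [∀ p, Module R (J p)]

/-- The Hom-evaluation map `B ⊗ ∏ Hom(E, J) → ∏ Hom(Hom(B, E), J)`. -/
noncomputable def homEval (B : Type u) [AddCommGroup B] [Module R B] :
    B ⊗[R] (∀ p, E p →ₗ[R] J p) →ₗ[R] ∀ p, (B →ₗ[R] E p) →ₗ[R] J p :=
  TensorProduct.lift (LinearMap.mk₂ R (fun b t p => (t p) ∘ₗ LinearMap.applyₗ b)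
    (by intros; ext; simp) (by intros; ext; simp) (by intros; ext; simp) (by intros; ext; simp))

@[simp] theorem homEval_tmul {B : Type u} [AddCommGroup B] [Module R B] (b : B)
    (t : ∀ p, E p →ₗ[R] J p) (p : ι) (φ : B →ₗ[R] E p) :
    homEval R E J B (b ⊗ₜ t) p φ = t p (φ b) := rfl

theorem homEval_rTensor {B B' : Type u} [AddCommGroup B] [Module R B] [AddCommGroup B']
    [Module R B'] (s : B →ₗ[R] B') (x : B ⊗[R] (∀ p, E p →ₗ[R] J p)) (p : ι)
    (φ : B' →ₗ[R] E p) :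
    homEval R E J B' (s.rTensor _ x) p φ = homEval R E J B x p (φ ∘ₗ s) := by
  induction x with
  | zero => simp
  | tmul b t => simp
  | add x y hx hy => simp [hx, hy]

theorem sum_rTensor_single_proj {n : ℕ} {N : Type u} [AddCommGroup N] [Module R N]
    (x : (Fin n → R) ⊗[R] N) :
    x = ∑ i, (LinearMap.toSpanSingleton R (Fin n → R) (Pi.single i 1)).rTensor N
      ((LinearMap.proj i : (Fin n → R) →ₗ[R] R).rTensor N x) := by
  induction x with
  | zero => simp
  | tmul v t =>
    simp only [LinearMap.rTensor_tmul, ← TensorProduct.sum_tmul]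
    congr 1
    ext j
    simp [Finset.sum_apply, Pi.single_apply]
  | add x y hx hy =>
    conv_lhs => rw [hx, hy]
    simp [Finset.sum_add_distrib]

theorem homEval_self_injective : Function.Injective (homEval R E J R) := by
  rw [injective_iff_map_eq_zero]
  intro x hx
  obtain ⟨t, rfl⟩ : ∃ t : ∀ p, E p →ₗ[R] J p, x = 1 ⊗ₜ t :=
    ⟨TensorProduct.lid R _ x, ((TensorProduct.lid R _).symm_apply_apply x).symm⟩
  have : t = 0 := by
    funext p
    ext e
    have := congrArg (fun f => f p (LinearMap.toSpanSingleton R _ e)) hx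
    simpa using this
  simp [this]

theorem homEval_pi_bijective (n : ℕ) : Function.Bijective (homEval R E J (Fin n → R)) := by
  constructor
  · rw [injective_iff_map_eq_zero]
    intro x hx
    rw [sum_rTensor_single_proj R x]
    refine Finset.sum_eq_zero fun i _ => ?_
    have : (LinearMap.proj i : (Fin n → R) →ₗ[R] R).rTensor (∀ p, E p →ₗ[R] J p) x = 0 := by
      apply homEval_self_injective R E J
      funext p
      ext φ
      simp [homEval_rTensor, hx]
    rw [this, map_zero]
  · intro y
    refine ⟨∑ i, (Pi.single i 1 : Fin n → R) ⊗ₜ fun p => (y p) ∘ₗ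
      LinearMap.smulRightₗ (LinearMap.proj i : (Fin n → R) →ₗ[R] R), ?_⟩
    funext p
    refine LinearMap.ext fun φ => ?_
    have h : φ = ∑ i, LinearMap.smulRightₗ (LinearMap.proj i : (Fin n → R) →ₗ[R] R)
        (φ (Pi.single i 1)) := by
      ext i
      simp [Pi.single_apply, Finset.sum_apply]
    conv_rhs => rw [h]
    simp [Finset.sum_apply]

theorem homEval_surjective (hJ : ∀ p, Module.Injective R (J p)) (B : Type u) [AddCommGroup B]
    [Module R B] [Module.Finite R B] : Function.Surjective (homEval R E J B) := by
  obtain ⟨n, s, hs⟩ := Module.Finite.exists_fin' R B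
  intro y
  have h (p : ι) : ∃ z : ((Fin n → R) →ₗ[R] E p) →ₗ[R] J p, z ∘ₗ LinearMap.lcomp R (E p) s = y p :=
    (hJ p).exists_comp_eq_of_ker_le _ _ fun φ hφ => by
      have : φ = 0 := LinearMap.cancel_right hs |>.mp hφ
      simp [this]
  choose z hz using h
  obtain ⟨x, hx⟩ := (homEval_pi_bijective R E J n).2 z
  refine ⟨s.rTensor _ x, ?_⟩
  funext p
  refine LinearMap.ext fun φ => ?_
  rw [homEval_rTensor, hx, ← hz]
  rfl

theorem homEval_bijective [IsNoetherianRing R] (hJ : ∀ p, Module.Injective R (J p))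
    (B : Type u) [AddCommGroup B] [Module R B] [Module.Finite R B] :
    Function.Bijective (homEval R E J B) := by
  refine ⟨?_, homEval_surjective R E J hJ B⟩
  rw [injective_iff_map_eq_zero]
  intro x hx
  obtain ⟨n, s, hs⟩ := Module.Finite.exists_fin' R B
  obtain ⟨y, rfl⟩ := LinearMap.rTensor_surjective _ hs x
  let K := LinearMap.ker s
  have h (p : ι) : ∃ z : (K →ₗ[R] E p) →ₗ[R] J p,
      z ∘ₗ LinearMap.lcomp R (E p) K.subtype = homEval R E J _ y p :=
    (hJ p).exists_comp_eq_of_ker_le _ _ fun φ hφ => by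
      have hle : LinearMap.ker s ≤ LinearMap.ker φ := fun k hk =>
        LinearMap.congr_fun (show φ ∘ₗ K.subtype = 0 from hφ) ⟨k, hk⟩
      let ψ : B →ₗ[R] E p := (LinearMap.ker s).liftQ φ hle ∘ₗ
        (s.quotKerEquivOfSurjective hs).symm.toLinearMap
      have hψ : ψ ∘ₗ s = φ := by
        refine LinearMap.ext fun v => ?_
        have : (s.quotKerEquivOfSurjective hs).symm (s v) = Submodule.Quotient.mk v := by
          rw [LinearEquiv.symm_apply_eq]; rfl
        simp [ψ, this]
      rw [LinearMap.mem_ker, ← hψ, ← homEval_rTensor, hx]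
      rfl
  choose z hz using h
  obtain ⟨w, hw⟩ := homEval_surjective R E J hJ K z
  have hy : y = K.subtype.rTensor _ w := by
    apply (homEval_pi_bijective R E J n).1
    funext p
    refine LinearMap.ext fun φ => ?_
    rw [homEval_rTensor, hw, ← hz]
    rfl
  rw [hy, ← LinearMap.comp_apply, ← LinearMap.rTensor_comp]
  have : s ∘ₗ K.subtype = 0 := by ext k; exact k.2
  simp [this]

/-- If every `B' → E p` extends along `s : B' → B`, then `s ⊗ ∏ Hom(E, J)` is injective. -/
theorem rTensor_pi_hom_injective [IsNoetherianRing R] (hJ : ∀ p, Module.Injective R (J p))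
    {B' B : Type u} [AddCommGroup B] [Module R B] [AddCommGroup B'] [Module R B']
    [Module.Finite R B'] (s : B' →ₗ[R] B)
    (hs : ∀ p (φ : B' →ₗ[R] E p), ∃ ψ : B →ₗ[R] E p, ψ ∘ₗ s = φ) :
    Function.Injective (s.rTensor (∀ p, E p →ₗ[R] J p)) := by
  rw [injective_iff_map_eq_zero]
  intro x hx
  apply (homEval_bijective R E J hJ B').1
  funext p
  refine LinearMap.ext fun φ => ?_
  obtain ⟨ψ, rfl⟩ := hs p φ
  rw [← homEval_rTensor, hx]
  simp

theorem flat_pi_hom [IsNoetherianRing R] (hE : ∀ p, Module.Injective R (E p))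
    (hJ : ∀ p, Module.Injective R (J p)) : Module.Flat R (∀ p, E p →ₗ[R] J p) := by
  rw [Module.Flat.iff_rTensor_injective']
  intro I
  refine rTensor_pi_hom_injective R E J hJ _ fun p φ =>
    (hE p).exists_comp_eq_of_ker_le _ _ ?_
  rw [Submodule.ker_subtype]
  exact bot_le

end homEval

theorem rTensor_hom_injective [IsNoetherianRing R] {E J : Type u} [AddCommGroup E] [Module R E]
    [AddCommGroup J] [Module R J] (hJ : Module.Injective R J)
    {B' B : Type u} [AddCommGroup B] [Module R B] [AddCommGroup B'] [Module R B']
    [Module.Finite R B'] (s : B' →ₗ[R] B)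
    (hs : ∀ (φ : B' →ₗ[R] E), ∃ ψ : B →ₗ[R] E, ψ ∘ₗ s = φ) :
    Function.Injective (s.rTensor (E →ₗ[R] J)) := by
  have h := rTensor_pi_hom_injective R (ι := PUnit) (fun _ => E) (fun _ => J) (fun _ => hJ) s
    (fun _ => hs)
  let e : (PUnit → E →ₗ[R] J) ≃ₗ[R] (E →ₗ[R] J) := LinearEquiv.funUnique PUnit R _
  intro x y hxy
  apply (e.symm.lTensor B').injective
  apply h
  have (z : B' ⊗[R] (E →ₗ[R] J)) : s.rTensor _ (e.symm.lTensor B' z) = e.symm.lTensor B (s.rTensor _ z) := by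
    induction z with
    | zero => simp
    | tmul b t => simp
    | add x y hx hy => simp [hx, hy]
  rw [this, this, hxy]

end

section
variable {R : Type u} [CommRing R]

section lTensorHom

variable {G N B : Type u} [AddCommGroup G] [Module R G] [AddCommGroup N] [Module R N]
  [AddCommGroup B] [Module R B]

theorem lTensorHomToHomLTensor_lcomp {B' : Type u} [AddCommGroup B'] [Module R B']
    (s : B' →ₗ[R] B) (x : G ⊗[R] (B →ₗ[R] N)) :
    lTensorHomToHomLTensor (.id R) B' G N ((LinearMap.lcomp R N s).lTensor G x) =
      lTensorHomToHomLTensor (.id R) B G N x ∘ₗ s := by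
  induction x with
  | zero => simp
  | tmul b t => ext; simp
  | add x y hx hy => simp [hx, hy, LinearMap.add_comp]

variable (G N B) in
theorem lTensorHomToHomLTensor_injective [Module.Flat R G] [Module.Finite R B] :
    Function.Injective (lTensorHomToHomLTensor (.id R) B G N) := by
  obtain ⟨n, s, hs⟩ := Module.Finite.exists_fin' R B
  have h₁ : Function.Injective (LinearMap.lcomp R N s) := fun φ ψ h =>
    (LinearMap.cancel_right hs).mp h
  have h₂ := Module.Flat.lTensor_preserves_injective_linearMap (M := G) _ h₁
  have h₃ := (lTensorHomEquivHomLTensor R (Fin n → R) G N).injective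
  intro x y hxy
  refine h₂ (h₃ ?_)
  rw [lTensorHomEquivHomLTensor_apply, lTensorHomEquivHomLTensor_apply,
    lTensorHomToHomLTensor_lcomp, lTensorHomToHomLTensor_lcomp, hxy]

variable (G N B) in
/-- `G ⊗ Hom(B, N) → Hom(B, G ⊗ N)` is bijective for `G` flat and `B` finitely generated over a
noetherian ring. -/
theorem lTensorHomToHomLTensor_bijective [IsNoetherianRing R] [Module.Flat R G]
    [Module.Finite R B] : Function.Bijective (lTensorHomToHomLTensor (.id R) B G N) := by
  refine ⟨lTensorHomToHomLTensor_injective G N B, fun y => ?_⟩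
  obtain ⟨n, s, hs⟩ := Module.Finite.exists_fin' R B
  obtain ⟨w, hw⟩ := (lTensorHomEquivHomLTensor R (Fin n → R) G N).surjective (y ∘ₗ s)
  rw [lTensorHomEquivHomLTensor_apply] at hw
  have hex : Function.Exact (LinearMap.lcomp R N s)
      (LinearMap.lcomp R N (LinearMap.ker s).subtype) := by
    intro φ
    constructor
    · intro hφ
      have hle : LinearMap.ker s ≤ LinearMap.ker φ := fun k hk =>
        LinearMap.congr_fun (show φ ∘ₗ (LinearMap.ker s).subtype = 0 from hφ) ⟨k, hk⟩
      refine ⟨(LinearMap.ker s).liftQ φ hle ∘ₗ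
        (s.quotKerEquivOfSurjective hs).symm.toLinearMap, ?_⟩
      refine LinearMap.ext fun v => ?_
      have : (s.quotKerEquivOfSurjective hs).symm (s v) = Submodule.Quotient.mk v := by
        rw [LinearEquiv.symm_apply_eq]; rfl
      simp [this]
    · rintro ⟨ψ, rfl⟩
      ext k
      simp
  obtain ⟨v, hv⟩ := (Module.Flat.lTensor_exact G hex w).mp (by
    apply lTensorHomToHomLTensor_injective G N (LinearMap.ker s)
    rw [lTensorHomToHomLTensor_lcomp, hw, map_zero]
    ext k
    simp)
  refine ⟨v, (LinearMap.cancel_right hs).mp ?_⟩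
  rw [← lTensorHomToHomLTensor_lcomp, hv, hw]

end lTensorHom

/-- Over a noetherian ring, the tensor product of a flat and an injective module is injective. -/
theorem Module.Injective.tensorProduct_of_flat [IsNoetherianRing R] (G E : Type u) [AddCommGroup G]
    [Module R G] [AddCommGroup E] [Module R E] [Module.Flat R G] (hE : Module.Injective R E) :
    Module.Injective R (G ⊗[R] E) := by
  refine Module.Baer.injective fun I g => ?_
  obtain ⟨x, rfl⟩ := (lTensorHomToHomLTensor_bijective G E I).2 g
  have h : Function.Surjective (LinearMap.lcomp R E (Submodule.subtype I)) := fun φ =>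
    hE.exists_comp_eq_of_ker_le _ _ (by rw [Submodule.ker_subtype]; exact bot_le)
  obtain ⟨y, rfl⟩ := LinearMap.lTensor_surjective G h x
  refine ⟨lTensorHomToHomLTensor (.id R) R G E y, fun a ha => ?_⟩
  rw [lTensorHomToHomLTensor_lcomp]
  rfl

section hull

variable {E₀ : Type u} [AddCommGroup E₀] [Module R E₀]

/-- A submodule of an injective module has an injective essential extension inside it. -/
theorem Module.Injective.exists_essential_extension (h₀ : Module.Injective R E₀)
    (N : Submodule R E₀) : ∃ E : Submodule R E₀, N ≤ E ∧ Module.Injective R E ∧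
      ∀ x ∈ E, x ≠ 0 → ∃ a : R, a • x ≠ 0 ∧ a • x ∈ N := by
  obtain ⟨E, hNE, hE⟩ := zorn_le_nonempty₀
    {E : Submodule R E₀ | ∀ x ∈ E, x ≠ 0 → ∃ a : R, a • x ≠ 0 ∧ a • x ∈ N}
    (fun c hc hch y hy => ⟨sSup c, fun x hx hx0 => by
      obtain ⟨S, hS, hxS⟩ := (Submodule.mem_sSup_of_directed ⟨y, hy⟩ hch.directedOn).mp hx
      exact hc hS x hxS hx0, fun S hS => le_sSup hS⟩) N
    (fun x hx hx0 => ⟨1, by simpa using hx0, by simpa using hx⟩)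
  obtain ⟨H, -, hH⟩ := zorn_le_nonempty₀
    {H : Submodule R E₀ | ∀ x ∈ H, x ∈ E → x = 0}
    (fun c hc hch y hy => ⟨sSup c, fun x hx hxE => by
      obtain ⟨S, hS, hxS⟩ := (Submodule.mem_sSup_of_directed ⟨y, hy⟩ hch.directedOn).mp hx
      exact hc hS x hxS hxE, fun S hS => le_sSup hS⟩) ⊥
    (fun x hx _ => by simpa using hx)
  obtain ⟨φ, hφ⟩ := h₀.exists_comp_eq_of_ker_le (H.mkQ ∘ₗ E.subtype) E.subtype fun x hx => by
    have hxH : (x : E₀) ∈ H := by simpa using hx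
    simpa using hH.prop x hxH x.2
  have hrE (x : E₀) (hx : x ∈ E) : φ (H.mkQ x) = x := LinearMap.congr_fun hφ ⟨x, hx⟩
  have hle : E ≤ LinearMap.range (φ ∘ₗ H.mkQ) := fun x hx => ⟨x, hrE x hx⟩
  have hrange : LinearMap.range (φ ∘ₗ H.mkQ) ≤ E := by
    refine hE.le_of_ge ?_ hle
    rintro _ ⟨x, rfl⟩ hx0
    have hxH : x ∉ H := fun hx => hx0 (by simp [(Submodule.Quotient.mk_eq_zero H).mpr hx])
    have : ¬ (H ⊔ R ∙ x ∈ {H : Submodule R E₀ | ∀ x ∈ H, x ∈ E → x = 0}) := fun h =>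
      hxH (hH.le_of_ge h le_sup_left
        ((le_sup_right : R ∙ x ≤ H ⊔ R ∙ x) (Submodule.mem_span_singleton_self x)))
    simp only [Set.mem_ofPred_eq, not_forall] at this
    obtain ⟨e, heS, heE, he0⟩ := this
    obtain ⟨h, hhH, z, hz, rfl⟩ := Submodule.mem_sup.mp heS
    obtain ⟨a, rfl⟩ := Submodule.mem_span_singleton.mp hz
    have hay : a • (φ ∘ₗ H.mkQ) x = h + a • x := by
      rw [← hrE _ heE]
      simp [(Submodule.Quotient.mk_eq_zero H).mpr hhH]
    obtain ⟨b, hb0, hbN⟩ := hE.prop _ heE he0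
    exact ⟨b * a, by rwa [mul_smul, hay], by rwa [mul_smul, hay]⟩
  refine ⟨E, hNE, ⟨fun X Y _ _ _ _ f hf g => ?_⟩, hE.prop⟩
  obtain ⟨k, hk⟩ := h₀.out f hf (E.subtype ∘ₗ g)
  refine ⟨((φ ∘ₗ H.mkQ).codRestrict E fun x => hrange ⟨x, rfl⟩) ∘ₗ k, fun x => ?_⟩
  ext
  simpa [hk] using hrE _ (g x).2

variable (R) in
theorem Module.exists_injective_embedding (N : Type u) [AddCommGroup N] [Module R N] :
    ∃ (E : ModuleCat.{u} R) (f : N →ₗ[R] E), Module.Injective R E ∧ Function.Injective f := by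
  refine ⟨Injective.under (ModuleCat.of R N), (Injective.ι (ModuleCat.of R N)).hom,
    (Module.injective_iff_injective_object R _).mpr (Injective.injective_under (ModuleCat.of R N)), ?_⟩
  exact (ModuleCat.mono_iff_injective _).mp inferInstance

/-- The injective hull of `R ⧸ p` for a prime `p`, with `u₀` the class of `1`. -/
theorem Ideal.IsPrime.exists_injective_hull (p : Ideal R) (hp : p.IsPrime) :
    ∃ (E : ModuleCat.{u} R) (u₀ : E), Module.Injective R E ∧ (∀ a : R, a • u₀ = 0 ↔ a ∈ p) ∧
      (∀ a : R, a ∉ p → ∀ x : E, a • x = 0 → x = 0) ∧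
      ∀ x : E, (∀ a ∈ p, a • x = 0) → ∃ a : R, a ∉ p ∧ a • x ∈ R ∙ u₀ := by
  obtain ⟨E₀, f, h₀, hf⟩ := Module.exists_injective_embedding R (R ⧸ p)
  obtain ⟨E, hNE, hE, hess⟩ := h₀.exists_essential_extension (LinearMap.range f)
  have hann (a : R) : a • f 1 = 0 ↔ a ∈ p := by
    rw [← map_smul, map_eq_zero_iff f hf, ← Ideal.Quotient.eq_zero_iff_mem]
    simp [Algebra.smul_def]
  have hspan (y : E₀) (hy : y ∈ LinearMap.range f) : ∃ c : R, y = c • f 1 := by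
    obtain ⟨z, rfl⟩ := hy
    obtain ⟨c, rfl⟩ := Ideal.Quotient.mk_surjective z
    refine ⟨c, ?_⟩
    rw [← map_smul]
    simp [Algebra.smul_def]
  refine ⟨ModuleCat.of R E, ⟨f 1, hNE ⟨1, rfl⟩⟩, hE, fun a => ?_, fun a ha x hx => ?_,
    fun x hx => ?_⟩
  · rw [← hann, Subtype.ext_iff]
    rfl
  · by_contra hx0
    obtain ⟨b, hb0, hb⟩ := hess x x.2 (fun h => hx0 (Subtype.ext h))
    obtain ⟨c, hc⟩ := hspan _ hb
    have hcp : c ∉ p := fun h => hb0 (by rw [hc, hann]; exact h)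
    have : a * c ∈ p := by
      rw [← hann, mul_smul, ← hc, smul_comm, show a • (x : E₀) = 0 from congrArg Subtype.val hx,
        smul_zero]
    exact (hp.mem_or_mem this).elim ha hcp
  · by_cases hx0 : x = 0
    · exact ⟨1, fun h => hp.ne_top ((Ideal.eq_top_iff_one p).mpr h), by simp [hx0]⟩
    · obtain ⟨b, hb0, hb⟩ := hess x x.2 (fun h => hx0 (Subtype.ext h))
      obtain ⟨c, hc⟩ := hspan _ hb
      refine ⟨b, fun h => hb0 (congrArg Subtype.val (hx b h)), ?_⟩
      exact Submodule.mem_span_singleton.mpr ⟨c, Subtype.ext hc.symm⟩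

end hull

end

section
variable {R : Type u} [CommRing R]

/-- If `A → T → G → 0` is exact with `T` flat and `A → T` stays injective after tensoring with
all `R ⧸ I`, then `G` is flat. -/
theorem Module.Flat.of_exact_of_lTensor_quotient_injective {A T G : Type u} [AddCommGroup A]
    [Module R A] [AddCommGroup T] [Module R T] [AddCommGroup G] [Module R G] [Module.Flat R T]
    (f : A →ₗ[R] T) (g : T →ₗ[R] G) (hg : Function.Surjective g) (hfg : Function.Exact f g)
    (h : ∀ I : Ideal R, Function.Injective (f.lTensor (R ⧸ I))) : Module.Flat R G := by
  rw [Module.Flat.iff_rTensor_injective']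
  intro I
  rw [injective_iff_map_eq_zero]
  intro y hy
  obtain ⟨t, rfl⟩ := LinearMap.lTensor_surjective I hg y
  rw [← LinearMap.comp_apply, LinearMap.rTensor_comp_lTensor, ← LinearMap.lTensor_comp_rTensor,
    LinearMap.comp_apply] at hy
  obtain ⟨x, hx⟩ := (_root_.lTensor_exact R hfg hg _).mp hy
  have hI : Function.Exact (Submodule.subtype I) (Submodule.mkQ I) := by
    rw [LinearMap.exact_iff, Submodule.ker_mkQ, Submodule.range_subtype]
  have hx0 : (Submodule.mkQ I).rTensor A x = 0 := by
    apply h I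
    rw [map_zero, ← LinearMap.comp_apply, LinearMap.lTensor_comp_rTensor,
      ← LinearMap.rTensor_comp_lTensor, LinearMap.comp_apply, hx, ← LinearMap.comp_apply,
      ← LinearMap.rTensor_comp, hI.linearMap_comp_eq_zero]
    simp
  obtain ⟨z, rfl⟩ := (_root_.rTensor_exact A hI (Submodule.mkQ_surjective I) x).mp hx0
  have : t = f.lTensor I z := by
    apply Module.Flat.rTensor_preserves_injective_linearMap (M := T) (Submodule.subtype I)
      Subtype.val_injective
    rw [← hx, ← LinearMap.comp_apply, LinearMap.lTensor_comp_rTensor,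
      ← LinearMap.rTensor_comp_lTensor, LinearMap.comp_apply]
  rw [this, ← LinearMap.comp_apply, ← LinearMap.lTensor_comp, hfg.linearMap_comp_eq_zero]
  simp

/-- If `f ⊗ R ⧸ p` is injective for all primes `p`, then `f ⊗ B` is injective for all finitely
generated `B`, provided the target of `f` is flat. -/
theorem lTensor_injective_of_forall_prime [IsNoetherianRing R] {A T : Type u} [AddCommGroup A]
    [Module R A] [AddCommGroup T] [Module R T] [Module.Flat R T] (f : A →ₗ[R] T)
    (h : ∀ p : Ideal R, p.IsPrime → Function.Injective (f.lTensor (R ⧸ p)))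
    (B : Type u) [AddCommGroup B] [Module R B] [hB : Module.Finite R B] :
    Function.Injective (f.lTensor B) := by
  induction hB using IsNoetherianRing.induction_on_isQuotientEquivQuotientPrime R with
  | subsingleton N => exact Function.injective_of_subsingleton _
  | quotient N p e =>
    have : f.lTensor N = (e.symm.toLinearMap.rTensor T) ∘ₗ f.lTensor (R ⧸ p.1) ∘ₗ
        e.toLinearMap.rTensor A := by
      ext; simp
    rw [this]
    exact (e.symm.rTensor T).injective.comp ((h p.1 p.2).comp (e.rTensor A).injective)
  | exact N₁ N₂ N₃ s t hs ht hst h₁ h₃ =>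
    rw [injective_iff_map_eq_zero] at h₁ h₃ ⊢
    intro x hx
    have hx0 : t.rTensor A x = 0 := by
      apply h₃
      rw [← LinearMap.comp_apply, LinearMap.lTensor_comp_rTensor,
        ← LinearMap.rTensor_comp_lTensor, LinearMap.comp_apply, hx, map_zero]
    obtain ⟨y, rfl⟩ := (_root_.rTensor_exact A hst ht x).mp hx0
    rw [h₁ y, map_zero]
    apply Module.Flat.rTensor_preserves_injective_linearMap (M := T) s hs
    rw [map_zero, ← hx, ← LinearMap.comp_apply, LinearMap.rTensor_comp_lTensor,
      ← LinearMap.lTensor_comp_rTensor, LinearMap.comp_apply]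

/-- If `p G = G` for all primes `p ⊇ I`, then `I G = G`. -/
theorem Ideal.smul_top_eq_top_of_forall_prime [IsNoetherianRing R] {G : Type u} [AddCommGroup G]
    [Module R G] (I : Ideal R)
    (h : ∀ p : Ideal R, p.IsPrime → I ≤ p → p • (⊤ : Submodule R G) = ⊤) :
    I • (⊤ : Submodule R G) = ⊤ := by
  induction I using IsNoetherian.induction with
  | hgt I ih =>
    by_cases hI : I = ⊤
    · rw [hI, Submodule.top_smul]
    by_cases hp : Ideal.IsPrime I
    · exact h I hp le_rfl
    · have : ∃ x y, x * y ∈ I ∧ x ∉ I ∧ y ∉ I := by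
        by_contra! hcon
        exact hp ⟨hI, fun {x y} hxy => or_iff_not_imp_left.mpr (hcon x y hxy)⟩
      obtain ⟨x, y, hxy, hx, hy⟩ := this
      have hlt {z : R} (hz : z ∉ I) : I < I ⊔ Ideal.span {z} :=
        left_lt_sup.mpr fun hle => hz (hle (Ideal.mem_span_singleton_self z))
      have hstep {z : R} (hz : z ∉ I) : (I ⊔ Ideal.span {z}) • (⊤ : Submodule R G) = ⊤ :=
        ih _ (hlt hz) fun p hp hle => h p hp ((hlt hz).le.trans hle)
      have hmul : (I ⊔ Ideal.span {x}) * (I ⊔ Ideal.span {y}) ≤ I := by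
        rw [Ideal.sup_mul, Ideal.mul_sup (Ideal.span {x}), Ideal.span_singleton_mul_span_singleton]
        refine sup_le Ideal.mul_le_left (sup_le Ideal.mul_le_right ?_)
        simpa [Ideal.span_singleton_le_iff_mem] using hxy
      refine eq_top_iff.mpr ?_
      calc (⊤ : Submodule R G) = ((I ⊔ Ideal.span {x}) * (I ⊔ Ideal.span {y})) • ⊤ := by
            rw [Submodule.mul_smul, hstep hy, hstep hx]
        _ ≤ I • ⊤ := Submodule.smul_mono_left hmul

theorem subsingleton_quotient_tensor_iff (I : Ideal R) (G : Type u) [AddCommGroup G] [Module R G] :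
    Subsingleton ((R ⧸ I) ⊗[R] G) ↔ I • (⊤ : Submodule R G) = ⊤ := by
  rw [(TensorProduct.quotTensorEquivQuotSMul G I).toEquiv.subsingleton_congr,
    Submodule.Quotient.subsingleton_iff]

end

section
variable {R : Type u} [CommRing R]

section
variable {q : Ideal R} {E G : Type u} [AddCommGroup E] [Module R E] {u₀ : E}
  [AddCommGroup G] [Module R G]

theorem tmul_eq_zero_of_mem_smul_top {g : G} (hg : g ∈ q • (⊤ : Submodule R G)) {u : E}
    (hu : ∀ a ∈ q, a • u = 0) : g ⊗ₜ[R] u = 0 := by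
  induction hg using Submodule.smul_induction_on' with
  | smul a ha m _ => rw [TensorProduct.smul_tmul, hu a ha, TensorProduct.tmul_zero]
  | add x _ y _ hx hy => rw [TensorProduct.add_tmul, hx, hy, add_zero]

theorem exists_tmul_eq_of_forall_smul_eq_zero [IsNoetherianRing R] [Module.Flat R G]
    (hE : ∀ x : E, (∀ a ∈ q, a • x = 0) → ∃ a : R, a ∉ q ∧ a • x ∈ R ∙ u₀)
    (hG : ∀ a : R, a ∉ q → ∀ g : G, ∃ g' : G, g - a • g' ∈ q • (⊤ : Submodule R G))
    {w : G ⊗[R] E} (hw : ∀ a ∈ q, a • w = 0) : ∃ g : G, w = g ⊗ₜ u₀ := by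
  have hle : q ≤ LinearMap.ker (LinearMap.toSpanSingleton R (G ⊗[R] E) w) := fun a ha => by
    simpa using hw a ha
  obtain ⟨x, hx⟩ := (lTensorHomToHomLTensor_bijective G E (R ⧸ q)).2 (Submodule.liftQ q _ hle)
  have hw' : lTensorHomToHomLTensor (.id R) (R ⧸ q) G E x 1 = w := by
    rw [hx]
    exact (Submodule.liftQ_apply q (LinearMap.toSpanSingleton R (G ⊗[R] E) w) 1).trans (by simp)
  rw [← hw']
  clear hw' hx
  induction x with
  | zero => exact ⟨0, by simp⟩
  | add x y hx hy =>
    obtain ⟨g₁, h₁⟩ := hx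
    obtain ⟨g₂, h₂⟩ := hy
    exact ⟨g₁ + g₂, by simp [h₁, h₂, TensorProduct.add_tmul]⟩
  | tmul g φ =>
    have hφ : ∀ a ∈ q, a • φ 1 = 0 := fun a ha => by
      rw [← map_smul, Algebra.smul_def, mul_one, Ideal.Quotient.algebraMap_eq,
        Ideal.Quotient.eq_zero_iff_mem.mpr ha, map_zero]
    obtain ⟨a, ha, hau⟩ := hE _ hφ
    obtain ⟨c, hc⟩ := Submodule.mem_span_singleton.mp hau
    obtain ⟨g', hg'⟩ := hG a ha g
    have h := tmul_eq_zero_of_mem_smul_top hg' hφ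
    rw [TensorProduct.sub_tmul, sub_eq_zero] at h
    refine ⟨c • g', ?_⟩
    rw [lTensorHomToHomLTensor_apply, h, TensorProduct.smul_tmul, ← hc, TensorProduct.smul_tmul]

theorem exists_forall_eq_tmul [IsNoetherianRing R] [Module.Flat R G]
    (hu₀ : ∀ a ∈ q, a • u₀ = 0)
    (hinj : ∀ a : R, a ∉ q → ∀ x : E, a • x = 0 → x = 0)
    (hE : ∀ x : E, (∀ a ∈ q, a • x = 0) → ∃ a : R, a ∉ q ∧ a • x ∈ R ∙ u₀)
    (hG : ∀ a : R, a ∉ q → ∀ g : G, ∃ g' : G, g - a • g' ∈ q • (⊤ : Submodule R G))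
    (z : ((R ⧸ q) →ₗ[R] E) →ₗ[R] G ⊗[R] E) : ∃ g : G, ∀ φ, z φ = g ⊗ₜ φ 1 := by
  have hkill {N : Type u} [AddCommGroup N] [Module R N] (φ : (R ⧸ q) →ₗ[R] N) (a : R)
      (ha : a ∈ q) : a • φ = 0 := by
    refine LinearMap.ext fun b => ?_
    rw [LinearMap.smul_apply, ← map_smul, Algebra.smul_def, Ideal.Quotient.algebraMap_eq,
        Ideal.Quotient.eq_zero_iff_mem.mpr ha, zero_mul, map_zero, LinearMap.zero_apply]
  have hle : q ≤ LinearMap.ker (LinearMap.toSpanSingleton R E u₀) := fun a ha => by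
    simpa using hu₀ a ha
  let φ₀ : (R ⧸ q) →ₗ[R] E := Submodule.liftQ q _ hle
  have hφ₀ : φ₀ 1 = u₀ :=
    (Submodule.liftQ_apply q (LinearMap.toSpanSingleton R E u₀) 1).trans (by simp)
  obtain ⟨g, hg⟩ := exists_tmul_eq_of_forall_smul_eq_zero (w := z φ₀) hE hG fun a ha => by
    rw [← map_smul, hkill _ a ha, map_zero]
  refine ⟨g, fun φ => ?_⟩
  obtain ⟨a, ha, hau⟩ := hE (φ 1) fun a ha => by
    rw [← LinearMap.smul_apply, hkill _ a ha, LinearMap.zero_apply]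
  obtain ⟨c, hc⟩ := Submodule.mem_span_singleton.mp hau
  have hφ : a • φ = c • φ₀ := by
    refine LinearMap.ext fun b => ?_
    obtain ⟨b, rfl⟩ := Ideal.Quotient.mk_surjective b
    have : Ideal.Quotient.mk q b = b • (1 : R ⧸ q) := by simp [Algebra.smul_def]
    rw [this, map_smul, map_smul, LinearMap.smul_apply, LinearMap.smul_apply, hφ₀, hc]
  have hinj' : Function.Injective (LinearMap.lsmul R (G ⊗[R] E) a) := by
    have h := Module.Flat.lTensor_preserves_injective_linearMap (M := G) (LinearMap.lsmul R E a)
      ((injective_iff_map_eq_zero _).mpr fun x hx => hinj a ha x hx)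
    have heq : (LinearMap.lsmul R E a).lTensor G = LinearMap.lsmul R (G ⊗[R] E) a := by
      ext; simp
    rwa [heq] at h
  apply hinj'
  rw [LinearMap.lsmul_apply, LinearMap.lsmul_apply, ← map_smul, hφ, map_smul, hg,
    ← TensorProduct.tmul_smul, ← TensorProduct.tmul_smul, hc]

end

/-- `p G = G` for all primes `p` of height at least `n`. -/
def SMulTopOfHeightGE (n : ℕ) (G : Type u) [AddCommGroup G] [Module R G] : Prop :=
  ∀ p : Ideal R, p.IsPrime → n ≤ p.height → p • (⊤ : Submodule R G) = ⊤

/-- The natural map `G → ∏ Hom(E, G ⊗ E)`. -/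
noncomputable def toPiHomTensor (R : Type u) [CommRing R] {ι : Type u} (E : ι → ModuleCat.{u} R)
    (G : Type u) [AddCommGroup G] [Module R G] : G →ₗ[R] ∀ p, E p →ₗ[R] G ⊗[R] E p :=
  LinearMap.pi fun p => TensorProduct.mk R G (E p)

theorem homEval_lTensor_toPiHomTensor {ι : Type u} (E : ι → ModuleCat.{u} R)
    {G : Type u} [AddCommGroup G] [Module R G] {B : Type u} [AddCommGroup B] [Module R B]
    (x : B ⊗[R] G) (p : ι) (φ : B →ₗ[R] E p) :
    homEval R (fun p => E p) (fun p => G ⊗[R] E p) B ((toPiHomTensor R E G).lTensor B x) p φ =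
      φ.lTensor G (TensorProduct.comm R B G x) := by
  induction x with
  | zero => simp
  | tmul b g => simp [toPiHomTensor]
  | add x y hx hy => simp [hx, hy]

/-- A flat module which is `p`-divisible for all primes `p` of height `> n` embeds purely into a
product of modules `Hom(E, J)` with `E` and `J` injective, with cokernel `p`-divisible for all
primes `p` of height `≥ n`. -/
theorem exists_flat_coresolution_step [IsNoetherianRing R] (n : ℕ) (G : Type u) [AddCommGroup G]
    [Module R G] [Module.Flat R G] (hG : SMulTopOfHeightGE (R := R) (n + 1) G) :
    ∃ (ι : Type u) (E J : ι → ModuleCat.{u} R) (f : G →ₗ[R] ∀ p, E p →ₗ[R] J p),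
      (∀ p, Module.Injective R (E p)) ∧ (∀ p, Module.Injective R (J p)) ∧
      Function.Injective f ∧ Module.Flat R ((∀ p, E p →ₗ[R] J p) ⧸ LinearMap.range f) ∧
      SMulTopOfHeightGE (R := R) n ((∀ p, E p →ₗ[R] J p) ⧸ LinearMap.range f) := by
  let ι : Type u := {p : PrimeSpectrum R // p.asIdeal.height ≤ n}
  choose E u₀ hE hu₀ hinj hkill using fun p : ι =>
    Ideal.IsPrime.exists_injective_hull p.1.asIdeal p.1.2
  let J : ι → ModuleCat.{u} R := fun p => ModuleCat.of R (G ⊗[R] E p)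
  have hJ (p) : Module.Injective R (J p) := Module.Injective.tensorProduct_of_flat G (E p) (hE p)
  let f : G →ₗ[R] ∀ p, E p →ₗ[R] J p := toPiHomTensor R E G
  have hflat : Module.Flat R (∀ p, E p →ₗ[R] J p) :=
    flat_pi_hom R (fun p => E p) (fun p => J p) hE hJ
  have hprime (q : Ideal R) (hq : q.IsPrime) : Function.Injective (f.lTensor (R ⧸ q)) := by
    by_cases hn : q.height ≤ n
    · rw [injective_iff_map_eq_zero]
      intro x hx
      let p : ι := ⟨⟨q, hq⟩, hn⟩
      have hle : q ≤ LinearMap.ker (LinearMap.toSpanSingleton R (E p) (u₀ p)) := fun a ha => by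
        rw [LinearMap.mem_ker, LinearMap.toSpanSingleton_apply]
        exact (hu₀ p a).mpr ha
      let φ : (R ⧸ q) →ₗ[R] E p := Submodule.liftQ q _ hle
      have hφ : Function.Injective φ := by
        rw [← LinearMap.ker_eq_bot]
        refine Submodule.ker_liftQ_eq_bot _ _ _ fun a ha => (hu₀ p a).mp ?_
        rwa [LinearMap.mem_ker, LinearMap.toSpanSingleton_apply] at ha
      apply (TensorProduct.comm R (R ⧸ q) G).injective
      apply Module.Flat.lTensor_preserves_injective_linearMap (M := G) φ hφ
      rw [← homEval_lTensor_toPiHomTensor E x p φ, map_zero, map_zero]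
      have := congrArg (fun y => homEval R (fun p => E p) (fun p => J p) (R ⧸ q) y p φ) hx
      simpa using this
    · have := (subsingleton_quotient_tensor_iff q G).mpr (hG q hq (by
        push_cast
        exact Order.add_one_le_of_lt (not_le.mp hn)))
      exact Function.injective_of_subsingleton _
  have hfB (B : Type u) [AddCommGroup B] [Module R B] [Module.Finite R B] :
      Function.Injective (f.lTensor B) := lTensor_injective_of_forall_prime f hprime B
  refine ⟨ι, E, J, f, hE, hJ, ?_, ?_, ?_⟩
  · have h := hfB R
    intro x y hxy
    apply (TensorProduct.lid R G).symm.injective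
    apply h
    exact congrArg (fun t => (1 : R) ⊗ₜ[R] t) hxy
  · exact Module.Flat.of_exact_of_lTensor_quotient_injective f _
      (Submodule.mkQ_surjective _) (LinearMap.exact_map_mkQ_range f) fun I => hfB _
  · intro q hq hn
    have hq_not_le (p : ι) (hp : p.1.asIdeal ≠ q) : ∃ a ∈ q, a ∉ p.1.asIdeal := by
      by_contra! hcon
      have := p.1.2
      exact hp (Ideal.eq_of_le_of_height_le (I := q) hcon (p.2.trans hn)).symm
    have hsurj : Function.Surjective (f.lTensor (R ⧸ q)) := by
      intro y
      obtain ⟨g, hg⟩ : ∃ g : G, ∀ (p : ι), p.1.asIdeal = q → ∀ φ : (R ⧸ q) →ₗ[R] E p,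
          homEval R (fun p => E p) (fun p => J p) (R ⧸ q) y p φ = g ⊗ₜ[R] φ 1 := by
        by_cases h : ∃ p : ι, p.1.asIdeal = q
        · obtain ⟨p, rfl⟩ := h
          obtain ⟨g, hg⟩ := exists_forall_eq_tmul (fun a => (hu₀ p a).mpr) (hinj p) (hkill p)
            (G := G) (fun a ha g => by
              have h := Ideal.smul_top_eq_top_of_forall_prime (G := G)
                (p.1.asIdeal ⊔ Ideal.span {a}) fun P hP hle => hG P hP (by
                  have hlt : p.1.asIdeal < P := lt_of_le_of_ne (le_sup_left.trans hle) (by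
                    rintro heq
                    exact ha (heq ▸ hle (Ideal.mem_sup_right (Ideal.mem_span_singleton_self a))))
                  push_cast
                  exact (add_le_add_left hn 1).trans
                    (Ideal.height_add_one_le_of_lt_of_isPrime hlt))
              rw [Submodule.sup_smul] at h
              obtain ⟨x, hx, y, hy, rfl⟩ := Submodule.mem_sup.mp (h ▸ Submodule.mem_top : g ∈ _)
              rw [Submodule.ideal_span_singleton_smul] at hy
              obtain ⟨g', -, rfl⟩ := Submodule.mem_smul_pointwise_iff_exists _ _ _ |>.mp hy
              exact ⟨g', by simpa using hx⟩)
            (homEval R (fun p => E p) (fun p => J p) _ y p)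
          refine ⟨g, fun p' hp' => ?_⟩
          obtain rfl : p' = p := Subtype.ext (PrimeSpectrum.ext hp')
          exact hg
        · exact ⟨0, fun p hp => (h ⟨p, hp⟩).elim⟩
      refine ⟨1 ⊗ₜ g, (homEval_bijective R (fun p => E p) (fun p => J p) hJ _).1 ?_⟩
      funext p
      refine LinearMap.ext fun φ => ?_
      by_cases hp : p.1.asIdeal = q
      · rw [hg p hp]
        rfl
      · obtain ⟨a, haq, hap⟩ := hq_not_le p hp
        have : φ = 0 := by
          refine LinearMap.ext fun b => hinj p a hap _ ?_
          rw [← map_smul, Algebra.smul_def, Ideal.Quotient.algebraMap_eq,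
            Ideal.Quotient.eq_zero_iff_mem.mpr haq, zero_mul, map_zero]
        rw [this, map_zero, map_zero]
    rw [← subsingleton_quotient_tensor_iff]
    refine subsingleton_of_forall_eq 0 fun x => ?_
    obtain ⟨y, rfl⟩ := LinearMap.lTensor_surjective (R ⧸ q)
      (Submodule.mkQ_surjective (LinearMap.range f)) x
    obtain ⟨z, rfl⟩ := hsurj y
    rw [← LinearMap.comp_apply, ← LinearMap.lTensor_comp,
      (LinearMap.exact_map_mkQ_range f).linearMap_comp_eq_zero]
    simp

/-- Induction principle for flat modules over a noetherian ring of finite Krull dimension: every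
flat module has a finite coresolution by products of modules `Hom(E, J)`. -/
theorem Module.Flat.coresolution_induction [IsNoetherianRing R] (hdim : ringKrullDim R < ⊤)
    {P : ℕ → ModuleCat.{u} R → Prop} (zero : ∀ G : ModuleCat.{u} R, Subsingleton G → P 0 G)
    (step : ∀ (n : ℕ) (G G' : ModuleCat.{u} R) (ι : Type u) (E J : ι → ModuleCat.{u} R)
      (f : G →ₗ[R] ∀ p, E p →ₗ[R] J p) (g : (∀ p, E p →ₗ[R] J p) →ₗ[R] G'),
      (∀ p, Module.Injective R (E p)) → (∀ p, Module.Injective R (J p)) → Function.Injective f →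
      Function.Surjective g → Function.Exact f g → Module.Flat R G →
      Module.Flat R (∀ p, E p →ₗ[R] J p) → Module.Flat R G' → P n G' → P (n + 1) G) :
    ∃ N : ℕ, ∀ G : ModuleCat.{u} R, Module.Flat R G → P N G := by
  have key (n : ℕ) : ∀ G : ModuleCat.{u} R, Module.Flat R G →
      SMulTopOfHeightGE (R := R) n G → P n G := by
    induction n with
    | zero =>
      intro G _ hG
      refine zero G ?_
      have := Ideal.smul_top_eq_top_of_forall_prime (G := G) (⊥ : Ideal R)
        fun p hp _ => hG p hp (by simp)
      rw [Submodule.bot_smul] at this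
      exact (Submodule.subsingleton_iff R).mp (subsingleton_of_bot_eq_top this)
    | succ n ih =>
      intro G hGf hG
      obtain ⟨ι, E, J, f, hE, hJ, hf, hflat, hvan⟩ := exists_flat_coresolution_step n G hG
      exact step n G (ModuleCat.of R _) ι E J f (Submodule.mkQ (LinearMap.range f)) hE hJ hf
        (Submodule.mkQ_surjective _) (LinearMap.exact_map_mkQ_range f) hGf
        (flat_pi_hom R (fun p => E p) (fun p => J p) hE hJ) hflat (ih _ hflat hvan)
  obtain ⟨d, hd⟩ : ∃ d : ℕ, ringKrullDim R < d := by
    rcases h : ringKrullDim R with _ | _ | d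
    · exact ⟨0, WithBot.bot_lt_coe _⟩
    · exact absurd h hdim.ne
    · refine ⟨d + 1, ?_⟩
      change ((d : ℕ∞) : WithBot ℕ∞) < _
      exact_mod_cast Nat.lt_succ_self d
  refine ⟨d, fun G hG => key d G hG fun p hp hdp => ?_⟩
  have := (Ideal.height_le_ringKrullDim_of_isPrime (I := p)).trans_lt hd
  exact absurd hdp (not_le.mpr (by exact_mod_cast this))

end

section
variable {R : Type u} [CommRing R]

/-- `0 → A → B → D → 0` is exact. -/
structure IsShortExact {A B D : Type u} [AddCommGroup A] [Module R A] [AddCommGroup B] [Module R B]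
    [AddCommGroup D] [Module R D] (f : A →ₗ[R] B) (g : B →ₗ[R] D) : Prop where
  inj : Function.Injective f
  surj : Function.Surjective g
  exact : Function.Exact f g

theorem IsShortExact.of_ker {B D : Type u} [AddCommGroup B] [Module R B]
    [AddCommGroup D] [Module R D] (g : B →ₗ[R] D) (hg : Function.Surjective g) :
    IsShortExact (LinearMap.ker g).subtype g :=
  ⟨Subtype.val_injective, hg, g.exact_subtype_ker_map⟩

section flat

variable {A B D : Type u} [AddCommGroup A] [Module R A] [AddCommGroup B] [Module R B]
    [AddCommGroup D] [Module R D] {f : A →ₗ[R] B} {g : B →ₗ[R] D}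

theorem IsShortExact.lTensor (h : IsShortExact f g) [Module.Flat R D] (N : Type u) [AddCommGroup N]
    [Module R N] : IsShortExact (f.lTensor N) (g.lTensor N) :=
  ⟨LinearMap.lTensor_injective_of_exact_of_flat g h.surj f h.inj h.exact N,
    LinearMap.lTensor_surjective N h.surj, lTensor_exact N h.exact h.surj⟩

theorem IsShortExact.rTensor (h : IsShortExact f g) [Module.Flat R D] (N : Type u) [AddCommGroup N]
    [Module R N] : IsShortExact (f.rTensor N) (g.rTensor N) :=
  ⟨(LinearMap.lTensor_inj_iff_rTensor_inj N f).mp (h.lTensor N).inj,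
    LinearMap.rTensor_surjective N h.surj, rTensor_exact N h.exact h.surj⟩

theorem IsShortExact.flat_left (h : IsShortExact f g) [Module.Flat R B] [Module.Flat R D] :
    Module.Flat R A := by
  rw [Module.Flat.iff_rTensor_injective']
  intro I
  have h₁ := (Module.Flat.rTensor_preserves_injective_linearMap (M := B) (Submodule.subtype I)
    Subtype.val_injective).comp (h.lTensor I).inj
  rw [← LinearMap.coe_comp, LinearMap.rTensor_comp_lTensor, ← LinearMap.lTensor_comp_rTensor] at h₁
  exact Function.Injective.of_comp h₁

theorem IsShortExact.flat_mid (h : IsShortExact f g) [Module.Flat R A] [Module.Flat R D] :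
    Module.Flat R B := by
  rw [Module.Flat.iff_rTensor_injective']
  intro I
  rw [injective_iff_map_eq_zero]
  intro x hx
  have hx0 : g.lTensor I x = 0 := by
    apply Module.Flat.rTensor_preserves_injective_linearMap (M := D) (Submodule.subtype I)
      Subtype.val_injective
    rw [← LinearMap.comp_apply, LinearMap.rTensor_comp_lTensor, ← LinearMap.lTensor_comp_rTensor,
      LinearMap.comp_apply, hx, map_zero, map_zero]
  obtain ⟨y, rfl⟩ := ((h.lTensor I).exact x).mp hx0
  have : y = 0 := by
    apply Module.Flat.rTensor_preserves_injective_linearMap (M := A) (Submodule.subtype I)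
      Subtype.val_injective
    apply (h.lTensor R).inj
    rw [← LinearMap.comp_apply, LinearMap.lTensor_comp_rTensor, ← LinearMap.rTensor_comp_lTensor,
      LinearMap.comp_apply, hx, map_zero, map_zero]
  rw [this, map_zero]

end flat

/-- `Ext^i(A, V) = 0` for all `i ≥ 1`. -/
def ExtVanish (A V : ModuleCat.{u} R) : Prop := ∀ n : ℕ, Subsingleton (Abelian.Ext A V (n + 1))

section ext

variable {A B D V : ModuleCat.{u} R} {f : A →ₗ[R] B} {g : B →ₗ[R] D}

theorem IsShortExact.shortExact (h : IsShortExact f g) :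
    (ModuleCat.shortComplexOfCompEqZero f g h.exact.linearMap_comp_eq_zero).ShortExact :=
  ModuleCat.shortComplex_shortExact _ h.exact h.inj h.surj

theorem ExtVanish.of_projective [Module.Projective R A] : ExtVanish A V := fun n =>
  haveI : Projective A := (IsProjective.iff_projective (R := R) A).mp inferInstance
  Abelian.Ext.subsingleton_of_projective A V n

theorem IsShortExact.subsingleton_ext_left (h : IsShortExact f g) {n : ℕ}
    [Subsingleton (Abelian.Ext B V n)] [Subsingleton (Abelian.Ext D V (n + 1))] :
    Subsingleton (Abelian.Ext A V n) :=
  subsingleton_of_forall_eq 0 fun x => by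
    obtain ⟨y, rfl⟩ := Abelian.Ext.contravariant_sequence_exact₁ h.shortExact V x (add_comm 1 n)
      (Subsingleton.elim (α := Abelian.Ext D V (n + 1)) _ _)
    rw [Subsingleton.elim (α := Abelian.Ext B V n) y 0, Abelian.Ext.comp_zero]

theorem IsShortExact.subsingleton_ext_mid (h : IsShortExact f g) {n : ℕ}
    [Subsingleton (Abelian.Ext A V n)] [Subsingleton (Abelian.Ext D V n)] :
    Subsingleton (Abelian.Ext B V n) :=
  subsingleton_of_forall_eq 0 fun x => by
    obtain ⟨y, rfl⟩ := Abelian.Ext.contravariant_sequence_exact₂ h.shortExact V x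
      (Subsingleton.elim (α := Abelian.Ext A V n) _ _)
    rw [Subsingleton.elim (α := Abelian.Ext D V n) y 0, Abelian.Ext.comp_zero]

theorem IsShortExact.subsingleton_ext_right (h : IsShortExact f g) {n : ℕ}
    [Subsingleton (Abelian.Ext A V n)] [Subsingleton (Abelian.Ext B V (n + 1))] :
    Subsingleton (Abelian.Ext D V (n + 1)) :=
  subsingleton_of_forall_eq 0 fun x => by
    obtain ⟨y, rfl⟩ := Abelian.Ext.contravariant_sequence_exact₃ h.shortExact V x
      (Subsingleton.elim (α := Abelian.Ext B V (n + 1)) _ _) (add_comm 1 n)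
    rw [Subsingleton.elim (α := Abelian.Ext A V n) y 0, Abelian.Ext.comp_zero]

theorem IsShortExact.subsingleton_ext_one_right (h : IsShortExact f g)
    [Subsingleton (Abelian.Ext B V 1)] (hV : ∀ k : A →ₗ[R] V, ∃ l : B →ₗ[R] V, l ∘ₗ f = k) :
    Subsingleton (Abelian.Ext D V 1) :=
  subsingleton_of_forall_eq 0 fun x => by
    obtain ⟨y, rfl⟩ := Abelian.Ext.contravariant_sequence_exact₃ h.shortExact V x
      (Subsingleton.elim (α := Abelian.Ext B V 1) _ _) (add_comm 1 0)
    obtain ⟨k, rfl⟩ := Abelian.Ext.homEquiv₀.symm.surjective y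
    obtain ⟨l, hl⟩ := hV k.hom
    have hk : k = (ModuleCat.shortComplexOfCompEqZero f g h.exact.linearMap_comp_eq_zero).f ≫
        ModuleCat.ofHom l := by
      ext x
      exact (LinearMap.congr_fun hl x).symm
    rw [Abelian.Ext.homEquiv₀_symm_apply, hk, ← Abelian.Ext.mk₀_comp_mk₀,
      h.shortExact.extClass_comp_assoc]

theorem IsShortExact.exists_extension (h : IsShortExact f g) [Subsingleton (Abelian.Ext D V 1)]
    (k : A →ₗ[R] V) : ∃ l : B →ₗ[R] V, l ∘ₗ f = k := by
  obtain ⟨y, hy⟩ := Abelian.Ext.contravariant_sequence_exact₁ h.shortExact V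
    (Abelian.Ext.mk₀ (ModuleCat.ofHom k)) (add_comm 1 0)
      (Subsingleton.elim (α := Abelian.Ext D V 1) _ _)
  obtain ⟨l, rfl⟩ := Abelian.Ext.homEquiv₀.symm.surjective y
  rw [Abelian.Ext.homEquiv₀_symm_apply, Abelian.Ext.mk₀_comp_mk₀] at hy
  have := Abelian.Ext.homEquiv₀.symm.injective hy
  exact ⟨l.hom, by simpa using congrArg ModuleCat.Hom.hom this⟩

theorem IsShortExact.exists_lift (h : IsShortExact f g) [Subsingleton (Abelian.Ext V A 1)]
    (k : V →ₗ[R] D) : ∃ l : V →ₗ[R] B, g ∘ₗ l = k := by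
  obtain ⟨y, hy⟩ := Abelian.Ext.covariant_sequence_exact₃ V h.shortExact
    (Abelian.Ext.mk₀ (ModuleCat.ofHom k)) (add_comm 0 1)
      (Subsingleton.elim (α := Abelian.Ext V A 1) _ _)
  obtain ⟨l, rfl⟩ := Abelian.Ext.homEquiv₀.symm.surjective y
  rw [Abelian.Ext.homEquiv₀_symm_apply, Abelian.Ext.mk₀_comp_mk₀] at hy
  have := Abelian.Ext.homEquiv₀.symm.injective hy
  exact ⟨l.hom, by simpa using congrArg ModuleCat.Hom.hom this⟩

theorem IsShortExact.subsingleton_ext_covariant (h : IsShortExact f g) {n : ℕ}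
    [Subsingleton (Abelian.Ext V D n)] [Subsingleton (Abelian.Ext V B (n + 1))] :
    Subsingleton (Abelian.Ext V A (n + 1)) :=
  subsingleton_of_forall_eq 0 fun x => by
    obtain ⟨y, rfl⟩ := Abelian.Ext.covariant_sequence_exact₁ V h.shortExact x
      (Subsingleton.elim (α := Abelian.Ext V B (n + 1)) _ _) rfl
    rw [Subsingleton.elim (α := Abelian.Ext V D n) y 0, Abelian.Ext.zero_comp]

theorem IsShortExact.extVanish_left (h : IsShortExact f g) (hB : ExtVanish B V)
    (hD : ExtVanish D V) : ExtVanish A V := fun n =>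
  haveI := hB n
  haveI := hD (n + 1)
  h.subsingleton_ext_left

theorem IsShortExact.extVanish_mid (h : IsShortExact f g) (hA : ExtVanish A V)
    (hD : ExtVanish D V) : ExtVanish B V := fun n =>
  haveI := hA n
  haveI := hD n
  h.subsingleton_ext_mid

end ext

/-- Vanishing of `Ext` from an infinite left resolution on which `Hom(-, V)` is exact. -/
theorem ExtVanish.of_resolution {V : ModuleCat.{u} R} (A B : ℕ → ModuleCat.{u} R)
    (f : ∀ n, A (n + 1) →ₗ[R] B n) (g : ∀ n, B n →ₗ[R] A n) (h : ∀ n, IsShortExact (f n) (g n))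
    (hB : ∀ n, ExtVanish (B n) V)
    (hV : ∀ n (k : A (n + 1) →ₗ[R] V), ∃ l : B n →ₗ[R] V, l ∘ₗ f n = k) (m : ℕ) :
    ExtVanish (A m) V := by
  intro n
  induction n generalizing m with
  | zero =>
    have := hB m 0
    exact (h m).subsingleton_ext_one_right (hV m)
  | succ n ih =>
    have := hB m (n + 1)
    have := ih (m + 1)
    exact (h m).subsingleton_ext_right

end

section
variable {R : Type u} [CommRing R]

theorem exists_resolution {Q T : ModuleCat.{u} R → Prop}
    (h : ∀ A, Q A → ∃ (A' B : ModuleCat.{u} R) (f : A' →ₗ[R] B) (g : B →ₗ[R] A),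
      IsShortExact f g ∧ Q A' ∧ T B) (M : ModuleCat.{u} R) (hM : Q M) :
    ∃ (A B : ℕ → ModuleCat.{u} R) (f : ∀ n, A (n + 1) →ₗ[R] B n) (g : ∀ n, B n →ₗ[R] A n),
      A 0 = M ∧ (∀ n, IsShortExact (f n) (g n)) ∧ (∀ n, Q (A n)) ∧ ∀ n, T (B n) := by
  choose A' B f g hfg hA' hB using h
  let A : ℕ → {A : ModuleCat.{u} R // Q A} := fun n =>
    Nat.rec ⟨M, hM⟩ (fun _ A => ⟨A' A.1 A.2, hA' A.1 A.2⟩) n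
  exact ⟨fun n => (A n).1, fun n => B (A n).1 (A n).2, fun n => f (A n).1 (A n).2,
    fun n => g (A n).1 (A n).2, rfl, fun n => hfg _ _, fun n => (A n).property, fun n => hB _ _⟩

theorem exists_projective_presentation (A : ModuleCat.{u} R) :
    ∃ (A' B : ModuleCat.{u} R) (f : A' →ₗ[R] B) (g : B →ₗ[R] A),
      IsShortExact f g ∧ Module.Projective R B :=
  ⟨.of R (LinearMap.ker (Finsupp.linearCombination R (id : A → A))), .of R (A →₀ R), _, _,
    IsShortExact.of_ker _ (Finsupp.linearCombination_id_surjective R A),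
    inferInstanceAs (Module.Projective R (A →₀ R))⟩

theorem exists_flat_presentation (A : ModuleCat.{u} R) (hA : Module.Flat R A) :
    ∃ (A' B : ModuleCat.{u} R) (f : A' →ₗ[R] B) (g : B →ₗ[R] A),
      IsShortExact f g ∧ Module.Flat R A' ∧ Module.Projective R B := by
  obtain ⟨A', B, f, g, h, hB⟩ := exists_projective_presentation A
  exact ⟨A', B, f, g, h, h.flat_left, hB⟩

theorem exists_finite_presentation [IsNoetherianRing R] (A : ModuleCat.{u} R)
    (hA : Module.Finite R A) :
    ∃ (A' B : ModuleCat.{u} R) (f : A' →ₗ[R] B) (g : B →ₗ[R] A),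
      IsShortExact f g ∧ Module.Finite R A' ∧ (Module.Finite R B ∧ Module.Projective R B) := by
  obtain ⟨n, s, hs⟩ := Module.Finite.exists_fin' R A
  obtain ⟨B, ⟨e⟩⟩ : ∃ B : ModuleCat.{u} R, Nonempty (B ≃ₗ[R] (Fin n → R)) :=
    ⟨.of R (Fin n → R), ⟨LinearEquiv.refl R _⟩⟩
  have : Module.Finite R B := Module.Finite.equiv e.symm
  exact ⟨.of R (LinearMap.ker (s ∘ₗ e.toLinearMap)), B, _, s ∘ₗ e.toLinearMap,
    IsShortExact.of_ker _ (hs.comp e.surjective),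
    inferInstanceAs (Module.Finite R (LinearMap.ker (s ∘ₗ e.toLinearMap))),
    this, Module.Projective.of_equiv e.symm⟩

theorem exists_extension_hom {E J A B : Type u} [AddCommGroup E] [Module R E] [AddCommGroup J]
    [Module R J] [AddCommGroup A] [Module R A] [AddCommGroup B] [Module R B]
    (hJ : Module.Injective R J) (f : A →ₗ[R] B) (hf : Function.Injective (f.rTensor E))
    (k : A →ₗ[R] E →ₗ[R] J) : ∃ l : B →ₗ[R] E →ₗ[R] J, l ∘ₗ f = k := by
  obtain ⟨l, hl⟩ := hJ.exists_comp_eq_of_ker_le (f.rTensor E) (TensorProduct.lift k)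
    (by rw [LinearMap.ker_eq_bot.mpr hf]; exact bot_le)
  refine ⟨TensorProduct.curry l, LinearMap.ext fun a => LinearMap.ext fun e => ?_⟩
  simpa using LinearMap.congr_fun hl (a ⊗ₜ e)

theorem exists_extension_pi_hom {ι : Type u} {E J : ι → ModuleCat.{u} R} {A B : Type u}
    [AddCommGroup A] [Module R A] [AddCommGroup B] [Module R B]
    (hJ : ∀ p, Module.Injective R (J p)) (f : A →ₗ[R] B)
    (hf : ∀ p, Function.Injective (f.rTensor (E p)))
    (k : A →ₗ[R] ∀ p, E p →ₗ[R] J p) : ∃ l : B →ₗ[R] ∀ p, E p →ₗ[R] J p, l ∘ₗ f = k := by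
  choose l hl using fun p => exists_extension_hom (hJ p) f (hf p) (LinearMap.proj p ∘ₗ k)
  refine ⟨LinearMap.pi l, LinearMap.ext fun a => funext fun p => ?_⟩
  exact LinearMap.congr_fun (hl p) a

theorem ExtVanish.of_flat {V : ModuleCat.{u} R}
    (hV : ∀ (A B : ModuleCat.{u} R) (f : A →ₗ[R] B),
      (∀ E : ModuleCat.{u} R, Function.Injective (f.rTensor E)) →
      ∀ k : A →ₗ[R] V, ∃ l : B →ₗ[R] V, l ∘ₗ f = k)
    (F : ModuleCat.{u} R) (hF : Module.Flat R F) : ExtVanish F V := by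
  obtain ⟨A, B, f, g, rfl, h, hA, hB⟩ := exists_resolution exists_flat_presentation F hF
  exact ExtVanish.of_resolution A B f g h (fun n => haveI := hB n; .of_projective)
    (fun n => hV _ _ (f n) fun E => haveI := hA n; ((h n).rTensor E).inj) 0

theorem ExtVanish.of_flat_pi_hom {ι : Type u} (E J : ι → ModuleCat.{u} R)
    (hJ : ∀ p, Module.Injective R (J p)) (F : ModuleCat.{u} R) (hF : Module.Flat R F) :
    ExtVanish F (.of R (∀ p, E p →ₗ[R] J p)) :=
  .of_flat (fun _ _ f hf => exists_extension_pi_hom hJ f fun p => hf (E p)) F hF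

theorem ExtVanish.of_flat_hom (E J : ModuleCat.{u} R)
    (hJ : Module.Injective R J) (F : ModuleCat.{u} R) (hF : Module.Flat R F) :
    ExtVanish F (.of R (E →ₗ[R] J)) :=
  .of_flat (fun _ _ f hf => exists_extension_hom hJ f (hf E)) F hF

/-- `Ext^{k+1}(F, G) = 0` for all flat `G`. For flat modules `F` over the rings of interest this
bounds the projective dimension. -/
def PdLE (k : ℕ) (F : ModuleCat.{u} R) : Prop :=
  ∀ G : ModuleCat.{u} R, Module.Flat R G → Subsingleton (Abelian.Ext F G (k + 1))

theorem exists_forall_pdLE [IsNoetherianRing R] (hdim : ringKrullDim R < ⊤) :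
    ∃ N : ℕ, ∀ F : ModuleCat.{u} R, Module.Flat R F → PdLE N F := by
  obtain ⟨N, hN⟩ := Module.Flat.coresolution_induction hdim
    (P := fun n G => ∀ F : ModuleCat.{u} R, Module.Flat R F → ∀ i : ℕ,
      Subsingleton (Abelian.Ext F G (n + i + 1)))
    (fun G hG F hF i => subsingleton_of_forall_eq 0 fun x => by
      rw [← Abelian.Ext.comp_mk₀_id x, (ModuleCat.isZero_of_subsingleton G).eq_of_src (𝟙 G) 0,
        Abelian.Ext.mk₀_zero, Abelian.Ext.comp_zero])
    (fun n G G' ι E J f g hE hJ hf hg hfg hG hT hG' ih F hF i => by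
      have h : IsShortExact f g := ⟨hf, hg, hfg⟩
      rw [Nat.add_right_comm n 1 i]
      have := ih F hF i
      have := ExtVanish.of_flat_pi_hom E J hJ F hF (n + i + 1)
      exact IsShortExact.subsingleton_ext_covariant (B := ModuleCat.of R (∀ p, E p →ₗ[R] J p)) h)
  exact ⟨N, fun F hF G hG => hN G hG F hF 0⟩

theorem PdLE.projective {F : ModuleCat.{u} R} (h : PdLE 0 F) (hF : Module.Flat R F) :
    Module.Projective R F := by
  obtain ⟨A, B, f, g, hfg, hA, hB⟩ := exists_flat_presentation F hF
  have := h A hA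
  obtain ⟨s, hs⟩ := hfg.exists_lift (V := F) LinearMap.id
  exact Module.Projective.of_split s g hs

theorem PdLE.syzygy {k : ℕ} {A B F : ModuleCat.{u} R} {f : A →ₗ[R] B} {g : B →ₗ[R] F}
    (h : PdLE (k + 1) F) (hfg : IsShortExact f g) (hB : Module.Projective R B) : PdLE k A :=
  fun G hG => by
    have := h G hG
    have := ExtVanish.of_projective (A := B) (V := G) k
    exact hfg.subsingleton_ext_left

theorem PdLE.prod {k : ℕ} {F P : ModuleCat.{u} R} (h : PdLE k F) (hP : Module.Projective R P) :
    PdLE k (.of R (F × P)) := fun G hG => by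
  have := h G hG
  have := ExtVanish.of_projective (A := P) (V := G) k
  exact IsShortExact.subsingleton_ext_mid (B := ModuleCat.of R (F × P))
    ⟨LinearMap.inl_injective, LinearMap.snd_surjective, Function.Exact.inl_snd⟩

end

section
variable {R : Type u} [CommRing R]

theorem extZero.extVanish {M N : ModuleCat.{u} R} (h : extZero R M N) : ExtVanish M N := fun n =>
  subsingleton_of_forall_eq 0 fun α => by
    let P := ProjectiveResolution.of M
    obtain ⟨f, hf, rfl⟩ := P.extMk_surjective α (n + 2) rfl
    rw [P.extMk_eq_zero_iff f (n + 2) rfl hf n rfl]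
    have hz : Limits.IsZero ((P.complex.linearYonedaObj R N).homology (n + 1)) :=
      haveI := h (n + 1) (by omega)
      (ModuleCat.isZero_of_subsingleton _).of_iso (P.isoExt (n + 1) N).symm
    rw [← HomologicalComplex.exactAt_iff_isZero_homology,
      HomologicalComplex.exactAt_iff' _ n (n + 1) (n + 2) (by simp) (by simp),
      ShortComplex.moduleCat_exact_iff] at hz
    exact hz f hf

section coevaluation

variable {C : ModuleCat.{u} R} [IsNoetherianRing R] [Module.Finite R C]

theorem bijective_mk_of_flat (hC : Function.Bijective (LinearMap.lsmul R C)) (G : Type u)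
    [AddCommGroup G] [Module R G] [Module.Flat R G] :
    Function.Bijective (TensorProduct.mk R G C) := by
  have h := (lTensorHomToHomLTensor_bijective G C C).comp
    (((LinearEquiv.ofBijective _ hC).lTensor G).bijective.comp
      (TensorProduct.rid R G).symm.bijective)
  convert h using 1
  funext x
  ext c
  simp

theorem exists_rTensor_eq (hC : Function.Bijective (LinearMap.lsmul R C)) {G G' : Type u}
    [AddCommGroup G] [Module R G] [AddCommGroup G'] [Module R G'] [Module.Flat R G']
    (k : G ⊗[R] C →ₗ[R] G' ⊗[R] C) : ∃ m : G →ₗ[R] G', m.rTensor C = k := by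
  let e := LinearEquiv.ofBijective _ (bijective_mk_of_flat hC G')
  refine ⟨e.symm.toLinearMap ∘ₗ TensorProduct.curry k, TensorProduct.ext' fun x c => ?_⟩
  exact LinearMap.congr_fun (e.apply_symm_apply (TensorProduct.curry k x)) c

theorem exists_rTensor_comp_eq (hC : Function.Bijective (LinearMap.lsmul R C)) {P G G' : Type u}
    [AddCommGroup P] [Module R P] [AddCommGroup G] [Module R G] [AddCommGroup G'] [Module R G']
    [Module.Projective R P] [Module.Flat R G'] (g : G →ₗ[R] G') (hg : Function.Surjective g)
    (k : P ⊗[R] C →ₗ[R] G' ⊗[R] C) : ∃ l : P ⊗[R] C →ₗ[R] G ⊗[R] C, g.rTensor C ∘ₗ l = k := by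
  obtain ⟨m, rfl⟩ := exists_rTensor_eq hC k
  obtain ⟨m', rfl⟩ := Module.projective_lifting_property g m hg
  exact ⟨m'.rTensor C, (LinearMap.rTensor_comp _ _ _).symm⟩

end coevaluation

variable [IsNoetherianRing R] {C : ModuleCat.{u} R}

theorem IsSemidualizing.exists_resolution (hC : IsSemidualizing R C) :
    ∃ (A B : ℕ → ModuleCat.{u} R) (f : ∀ n, A (n + 1) →ₗ[R] B n) (g : ∀ n, B n →ₗ[R] A n),
      A 0 = C ∧ (∀ n, IsShortExact (f n) (g n)) ∧ (∀ n, Module.Finite R (A n)) ∧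
      (∀ n, Module.Projective R (B n)) ∧
      ∀ n (k : A (n + 1) →ₗ[R] C), ∃ l : B n →ₗ[R] C, l ∘ₗ f n = k := by
  obtain ⟨A, B, f, g, hA, h, hfin, hB⟩ := _root_.exists_resolution exists_finite_presentation C hC.1
  have hv (n : ℕ) : ExtVanish (A n) C := by
    induction n with
    | zero => rw [hA]; exact hC.2.2.extVanish
    | succ n ih => exact (h n).extVanish_left (haveI := (hB n).2; .of_projective) ih
  exact ⟨A, B, f, g, hA, h, hfin, fun n => (hB n).2, fun n => haveI := hv n 0
    (h n).exists_extension⟩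

theorem IsSemidualizing.extVanish_tensor (hC : IsSemidualizing R C) (L : ModuleCat.{u} R)
    [Module.Flat R L] : ExtVanish C (.of R (L ⊗[R] C)) := by
  obtain ⟨A, B, f, g, hA, h, hfin, hB, hex⟩ := hC.exists_resolution
  have := ExtVanish.of_resolution (V := .of R (L ⊗[R] C)) A B f g h
    (fun n => haveI := hB n; .of_projective) (fun n (k : A (n + 1) →ₗ[R] L ⊗[R] C) => by
      have := hfin (n + 1)
      obtain ⟨x, rfl⟩ := (lTensorHomToHomLTensor_bijective L C (A (n + 1))).2 k
      obtain ⟨y, rfl⟩ := LinearMap.lTensor_surjective L (g := LinearMap.lcomp R C (f n)) (hex n) x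
      exact ⟨lTensorHomToHomLTensor (.id R) (B n) L C y, by rw [lTensorHomToHomLTensor_lcomp]⟩) 0
  rwa [hA] at this

theorem IsSemidualizing.extVanish_hom_hom (hC : IsSemidualizing R C) (L I J : ModuleCat.{u} R)
    [Module.Flat R L] (hI : Module.Injective R I) (hJ : Module.Injective R J) :
    ExtVanish (.of R (L ⊗[R] C)) (.of R ((C →ₗ[R] I) →ₗ[R] J)) := by
  obtain ⟨A, B, f, g, hA, h, hfin, hB, hex⟩ := hC.exists_resolution
  have := ExtVanish.of_resolution (V := .of R ((C →ₗ[R] I) →ₗ[R] J))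
    (fun n => .of R (L ⊗[R] A n)) (fun n => .of R (L ⊗[R] B n)) (fun n => (f n).lTensor L)
    (fun n => (g n).lTensor L)
    (fun n => ⟨Module.Flat.lTensor_preserves_injective_linearMap _ (h n).inj,
      LinearMap.lTensor_surjective _ (h n).surj, lTensor_exact _ (h n).exact (h n).surj⟩)
    (fun n => haveI := hB n
      .of_flat_hom (.of R (C →ₗ[R] I)) J hJ (.of R (L ⊗[R] B n))
        (inferInstanceAs (Module.Flat R (L ⊗[R] B n))))
    (fun n => exists_extension_hom hJ ((f n).lTensor L) (by
      have := hfin (n + 1)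
      have h₁ := Module.Flat.lTensor_preserves_injective_linearMap (M := L) _
        (rTensor_hom_injective hI (f n) (hex n))
      have h₂ : ((f n).lTensor L).rTensor (C →ₗ[R] I) =
          (TensorProduct.assoc R L (B n) (C →ₗ[R] I)).symm.toLinearMap ∘ₗ
            ((f n).rTensor (C →ₗ[R] I)).lTensor L ∘ₗ
            (TensorProduct.assoc R L (A (n + 1)) (C →ₗ[R] I)).toLinearMap := by
        refine TensorProduct.ext_threefold fun x y z => ?_
        simp
      rw [h₂]
      exact (TensorProduct.assoc R L (B n) (C →ₗ[R] I)).symm.injective.comp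
        (h₁.comp (TensorProduct.assoc R L (A (n + 1)) (C →ₗ[R] I)).injective))) 0
  change ExtVanish (.of R (L ⊗[R] A 0)) _ at this
  rw [hA] at this
  exact this

theorem IsShortExact.isCFlat_mid (hC : IsSemidualizing R C) {A B D : ModuleCat.{u} R}
    {f : A →ₗ[R] B} {g : B →ₗ[R] D} (h : IsShortExact f g) (hA : IsCFlat R C A)
    (hD : IsCFlat R C D) : IsCFlat R C B := by
  obtain ⟨L', hL', ⟨e'⟩⟩ := hA
  obtain ⟨L, hL, ⟨e⟩⟩ := hD
  have := hC.1
  have := hC.extVanish_tensor L' 0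
  have h' : IsShortExact (A := ModuleCat.of R (L' ⊗[R] C)) (B := B)
      (D := ModuleCat.of R (L ⊗[R] C)) (f ∘ₗ e'.symm.toLinearMap) (e.toLinearMap ∘ₗ g) :=
    ⟨h.inj.comp e'.symm.injective, e.surjective.comp h.surj, fun y => by
      simp [h.exact y, e'.symm.surjective.exists]⟩
  generalize f ∘ₗ e'.symm.toLinearMap = f at h'
  generalize e.toLinearMap ∘ₗ g = g at h'
  have b' := bijective_mk_of_flat hC.2.1 L'
  have b := bijective_mk_of_flat hC.2.1 L
  let ε := LinearEquiv.ofBijective _ b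
  let α : L' →ₗ[R] (C →ₗ[R] B) := LinearMap.llcomp R C _ B f ∘ₗ TensorProduct.mk R L' C
  let β : (C →ₗ[R] B) →ₗ[R] L := ε.symm.toLinearMap ∘ₗ LinearMap.llcomp R C B (L ⊗[R] C) g
  have hβ (φ : C →ₗ[R] B) (c : C) : β φ ⊗ₜ[R] c = g (φ c) :=
    LinearMap.congr_fun (ε.apply_symm_apply (g ∘ₗ φ)) c
  have hs : IsShortExact α β := by
    refine ⟨fun x y hxy => b'.1 (LinearMap.ext fun c => h'.inj (LinearMap.congr_fun hxy c)),
      fun x => ?_, fun φ => ⟨fun hφ => ?_, ?_⟩⟩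
    · obtain ⟨l, hl⟩ := IsShortExact.exists_lift (V := C) (A := .of R (L' ⊗[R] C))
        (D := .of R (L ⊗[R] C)) h' (TensorProduct.mk R L C x)
      exact ⟨l, b.1 (LinearMap.ext fun c => (hβ l c).trans (LinearMap.congr_fun hl c))⟩
    · have hφ' (c : C) : φ c ∈ LinearMap.range f := (h'.exact _).mp (by
        rw [← hβ, hφ, TensorProduct.zero_tmul])
      let ef := LinearEquiv.ofInjective f h'.inj
      obtain ⟨x, hx⟩ := b'.2 (ef.symm.toLinearMap ∘ₗ φ.codRestrict _ hφ')
      refine ⟨x, LinearMap.ext fun c => ?_⟩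
      change f (TensorProduct.mk R L' C x c) = φ c
      rw [hx]
      exact congrArg Subtype.val (ef.apply_symm_apply (φ.codRestrict _ hφ' c))
    · rintro ⟨x, rfl⟩
      refine b.1 (LinearMap.ext fun c => (hβ _ c).trans ?_)
      simpa [α] using h'.exact.apply_apply_eq_zero _
  have hflat : Module.Flat R (C →ₗ[R] B) := hs.flat_mid
  let ev : (C →ₗ[R] B) ⊗[R] C →ₗ[R] B := TensorProduct.lift LinearMap.id
  have h₁ : ev ∘ₗ α.rTensor C = f := TensorProduct.ext' fun x c => rfl
  have h₂ : β.rTensor C = g ∘ₗ ev := TensorProduct.ext' fun φ c => hβ φ c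
  have hev : Function.Bijective ev := by
    have ht := hs.rTensor C
    constructor
    · rw [injective_iff_map_eq_zero]
      intro x hx
      obtain ⟨y, rfl⟩ := (ht.exact x).mp (by rw [h₂, LinearMap.comp_apply, hx, map_zero])
      rw [h'.inj ((LinearMap.congr_fun h₁ y).symm.trans (hx.trans (map_zero f).symm)), map_zero]
    · intro z
      obtain ⟨x, hx⟩ := ht.surj (g z)
      rw [h₂] at hx
      obtain ⟨y, hy⟩ := (h'.exact (z - ev x)).mp (by rw [map_sub, sub_eq_zero]; exact hx.symm)
      refine ⟨x + α.rTensor C y, ?_⟩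
      rw [map_add, ← LinearMap.comp_apply, h₁, hy, add_sub_cancel]
  exact ⟨.of R (C →ₗ[R] B), hflat, ⟨(LinearEquiv.ofBijective ev hev).symm⟩⟩

end

section
variable {R : Type u} [CommRing R]

theorem LinearMap.exists_comp_eq_of_surjective {A B V : Type u} [AddCommGroup A] [Module R A]
    [AddCommGroup B] [Module R B] [AddCommGroup V] [Module R V] (g : A →ₗ[R] B)
    (hg : Function.Surjective g) (k : A →ₗ[R] V) (h : LinearMap.ker g ≤ LinearMap.ker k) :
    ∃ l : B →ₗ[R] V, l ∘ₗ g = k := by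
  let e := g.quotKerEquivOfSurjective hg
  refine ⟨(LinearMap.ker g).liftQ k h ∘ₗ e.symm.toLinearMap, LinearMap.ext fun x => ?_⟩
  have : e.symm (g x) = Submodule.Quotient.mk x := by
    rw [LinearEquiv.symm_apply_eq]
    rfl
  simp [this]

section pullback

variable {U P G M M' : Type u} [AddCommGroup U] [Module R U] [AddCommGroup P] [Module R P]
  [AddCommGroup G] [Module R G] [AddCommGroup M] [Module R M] [AddCommGroup M'] [Module R M']
  {a : U →ₗ[R] P} {q : P →ₗ[R] G} {i : M →ₗ[R] G} {p : G →ₗ[R] M'}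

theorem IsShortExact.ker_comp (h : IsShortExact a q) (hG : IsShortExact i p) :
    ∃ (f : U →ₗ[R] LinearMap.ker (p ∘ₗ q)) (g : LinearMap.ker (p ∘ₗ q) →ₗ[R] M),
      IsShortExact f g ∧ (∀ u, (f u : P) = a u) ∧ ∀ x, i (g x) = q x := by
  have ha (u : U) : a u ∈ LinearMap.ker (p ∘ₗ q) := by simp [h.exact.apply_apply_eq_zero]
  let e := LinearEquiv.ofInjective i hG.inj
  have hq (x : LinearMap.ker (p ∘ₗ q)) : q x ∈ LinearMap.range i := (hG.exact _).mp x.2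
  let g : LinearMap.ker (p ∘ₗ q) →ₗ[R] M :=
    e.symm.toLinearMap ∘ₗ (q ∘ₗ Submodule.subtype _).codRestrict _ hq
  have hg (x) : i (g x) = q x := congrArg Subtype.val (e.apply_symm_apply ⟨q x, hq x⟩)
  refine ⟨a.codRestrict _ ha, g, ⟨fun x y hxy => h.inj (congrArg Subtype.val hxy), fun m => ?_,
    fun x => ?_⟩, fun u => rfl, hg⟩
  · obtain ⟨y, hy⟩ := h.surj (i m)
    refine ⟨⟨y, ?_⟩, hG.inj ((hg _).trans hy)⟩
    rw [LinearMap.mem_ker, LinearMap.comp_apply, hy, hG.exact.apply_apply_eq_zero]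
  · rw [← map_eq_zero_iff i hG.inj, hg, h.exact x]
    exact ⟨fun ⟨u, hu⟩ => ⟨u, Subtype.ext hu⟩, fun ⟨u, hu⟩ => ⟨u, congrArg Subtype.val hu⟩⟩

theorem IsShortExact.exists_extension_ker_comp (h : IsShortExact a q) (hG : IsShortExact i p)
    {V : Type u} [AddCommGroup V] [Module R V]
    (ha : ∀ k : U →ₗ[R] V, ∃ l : P →ₗ[R] V, l ∘ₗ a = k)
    (hi : ∀ k : M →ₗ[R] V, ∃ l : G →ₗ[R] V, l ∘ₗ i = k) (k : LinearMap.ker (p ∘ₗ q) →ₗ[R] V) :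
    ∃ l : P →ₗ[R] V, l ∘ₗ Submodule.subtype _ = k := by
  obtain ⟨f, g, hfg, hf, hg⟩ := h.ker_comp hG
  obtain ⟨l, hl⟩ := ha (k ∘ₗ f)
  obtain ⟨k', hk'⟩ := g.exists_comp_eq_of_surjective hfg.surj (k - l ∘ₗ Submodule.subtype _)
    fun x hx => by
      obtain ⟨u, rfl⟩ := (hfg.exact x).mp hx
      have := LinearMap.congr_fun hl u
      simp only [LinearMap.comp_apply] at this
      simp [hf, this]
  obtain ⟨l', rfl⟩ := hi k'
  refine ⟨l + l' ∘ₗ q, LinearMap.ext fun x => ?_⟩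
  have := LinearMap.congr_fun hk' x
  simp only [LinearMap.comp_apply, hg, LinearMap.sub_apply] at this
  simp [this]

/-- Splicing two presentations through a comparison map `s`. -/
theorem IsShortExact.splice {U' P' G' M'' : Type u} [AddCommGroup U'] [Module R U']
    [AddCommGroup P'] [Module R P'] [AddCommGroup G'] [Module R G'] [AddCommGroup M'']
    [Module R M''] {a' : U' →ₗ[R] P'} {q' : P' →ₗ[R] G'} {i' : M' →ₗ[R] G'} {p' : G' →ₗ[R] M''}
    (h' : IsShortExact a' q') (hG' : IsShortExact i' p') (hq : Function.Surjective (p ∘ₗ q))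
    (s : P →ₗ[R] P') (hs : q' ∘ₗ s = i' ∘ₗ p ∘ₗ q) :
    ∃ (f : LinearMap.ker (p ∘ₗ q) →ₗ[R] U' × P) (g : U' × P →ₗ[R] LinearMap.ker (p' ∘ₗ q')),
      IsShortExact f g ∧ ∀ x, (f x).2 = x := by
  have hs' (x) : q' (s x) = i' (p (q x)) := LinearMap.congr_fun hs x
  have hk (x : LinearMap.ker (p ∘ₗ q)) : s x ∈ LinearMap.range a' := by
    refine (h'.exact _).mp ?_
    rw [hs', show p (q x) = 0 from x.2, map_zero]
  let e := LinearEquiv.ofInjective a' h'.inj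
  let t : LinearMap.ker (p ∘ₗ q) →ₗ[R] U' :=
    e.symm.toLinearMap ∘ₗ (s ∘ₗ Submodule.subtype _).codRestrict _ hk
  have ht (x) : a' (t x) = s x := congrArg Subtype.val (e.apply_symm_apply ⟨s x, hk x⟩)
  have hm (y : U' × P) :
      (s ∘ₗ LinearMap.snd R U' P - a' ∘ₗ LinearMap.fst R U' P) y ∈ LinearMap.ker (p' ∘ₗ q') := by
    simp [hs', h'.exact.apply_apply_eq_zero, hG'.exact.apply_apply_eq_zero]
  refine ⟨t.prod (Submodule.subtype _), LinearMap.codRestrict _ _ hm, ⟨fun x y hxy => ?_,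
    fun y => ?_, fun y => ?_⟩, fun x => rfl⟩
  · exact Subtype.ext (congrArg Prod.snd hxy)
  · obtain ⟨m, hm⟩ := (hG'.exact (q' y)).mp y.2
    obtain ⟨x, rfl⟩ := hq m
    obtain ⟨u, hu⟩ := (h'.exact (s x - y)).mp (by
      rw [map_sub, hs', sub_eq_zero]
      exact hm)
    exact ⟨(u, x), Subtype.ext (by simp [hu])⟩
  · rw [← Subtype.val_inj]
    constructor
    · intro hy
      have hy' : s y.2 = a' y.1 := sub_eq_zero.mp hy
      have hy₂ : p (q y.2) = 0 := hG'.inj (by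
        rw [← hs', hy', h'.exact.apply_apply_eq_zero, map_zero])
      exact ⟨⟨y.2, hy₂⟩, Prod.ext (h'.inj ((ht _).trans hy')) rfl⟩
    · rintro ⟨x, rfl⟩
      exact sub_eq_zero.mpr (ht x).symm

end pullback

end

section
variable {R : Type u} [CommRing R]

/-- Maps into `Hom(Hom(C, I), J)` with `I`, `J` injective extend along `f`. -/
def HomHomExtends (C : ModuleCat.{u} R) {A B : Type u} [AddCommGroup A] [Module R A]
    [AddCommGroup B] [Module R B] (f : A →ₗ[R] B) : Prop :=
  ∀ I J : ModuleCat.{u} R, Module.Injective R I → Module.Injective R J →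
    ∀ k : A →ₗ[R] (C →ₗ[R] I) →ₗ[R] J, ∃ l : B →ₗ[R] (C →ₗ[R] I) →ₗ[R] J, l ∘ₗ f = k

theorem HomHomExtends.of_rTensor {C : ModuleCat.{u} R} {A B : Type u} [AddCommGroup A] [Module R A]
    [AddCommGroup B] [Module R B] (f : A →ₗ[R] B)
    (hf : ∀ J : ModuleCat.{u} R, IsCInjective R C J → Function.Injective (f.rTensor J)) :
    HomHomExtends C f := fun I _ hI hJ =>
  exists_extension_hom hJ f (hf (.of R (C →ₗ[R] I)) ⟨I, hI, ⟨LinearEquiv.refl R _⟩⟩)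

theorem HomHomExtends.rTensor {C : ModuleCat.{u} R} {A B D : Type u} [AddCommGroup A] [Module R A]
    [AddCommGroup B] [Module R B] [AddCommGroup D] [Module R D] {f : A →ₗ[R] B} {g : B →ₗ[R] D}
    (h : IsShortExact f g) [Module.Flat R D] : HomHomExtends C (f.rTensor C) :=
  .of_rTensor _ fun J _ => by
    have h₂ : (f.rTensor C).rTensor J = (TensorProduct.assoc R B C J).symm.toLinearMap ∘ₗ
        f.rTensor (C ⊗[R] J) ∘ₗ (TensorProduct.assoc R A C J).toLinearMap :=
      TensorProduct.ext_threefold fun x y z => by simp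
    rw [h₂]
    exact (TensorProduct.assoc R B C J).symm.injective.comp
      ((h.rTensor (C ⊗[R] J)).inj.comp (TensorProduct.assoc R A C J).injective)

/-- The modules `M n` are the cosyzygies of a coresolution `0 → M 0 → F 0 ⊗ C → F 1 ⊗ C → ⋯`
with `F n` flat of class `T`, which stays exact under `Hom(-, Hom(Hom(C, I), J))` for `I`, `J`
injective. -/
def HasCoresolution (C : ModuleCat.{u} R) (T : ModuleCat.{u} R → Prop) (M : ℕ → ModuleCat.{u} R) :
    Prop :=
  ∃ (F : ℕ → ModuleCat.{u} R) (i : ∀ n, M n →ₗ[R] F n ⊗[R] C)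
    (p : ∀ n, F n ⊗[R] C →ₗ[R] M (n + 1)), (∀ n, IsShortExact (i n) (p n)) ∧
    (∀ n, Module.Flat R (F n)) ∧ (∀ n, T (F n)) ∧ ∀ n, HomHomExtends C (i n)

variable [IsNoetherianRing R] {C : ModuleCat.{u} R}

theorem HasCoresolution.reduce (hC : IsSemidualizing R C) {k : ℕ} {M : ℕ → ModuleCat.{u} R}
    (h : HasCoresolution C (PdLE (k + 1)) M) :
    ∃ X : ℕ → ModuleCat.{u} R, HasCoresolution C (PdLE k) X ∧
      ∃ (K : ModuleCat.{u} R) (f : K →ₗ[R] X 0) (g : X 0 →ₗ[R] M 0),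
        IsShortExact f g ∧ IsCFlat R C K := by
  obtain ⟨F, i, p, hip, hF, hpd, hext⟩ := h
  choose F' P a b hab hF' hP using fun n => exists_flat_presentation (F n) (hF n)
  have := hC.1
  have hq (n : ℕ) : IsShortExact ((a n).rTensor C) ((b n).rTensor C) :=
    haveI := hF n
    (hab n).rTensor C
  have hs (n : ℕ) : ∃ s : P n ⊗[R] C →ₗ[R] P (n + 1) ⊗[R] C,
      (b (n + 1)).rTensor C ∘ₗ s = i (n + 1) ∘ₗ p n ∘ₗ (b n).rTensor C :=
    haveI := hF (n + 1)
    haveI := hP n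
    exists_rTensor_comp_eq hC.2.1 (b (n + 1)) (hab (n + 1)).surj _
  have hsurj (n : ℕ) : Function.Surjective (p n ∘ₗ (b n).rTensor C) :=
    (hip n).surj.comp (hq n).surj
  choose s hs using hs
  choose f g hfg hf using fun n => (hq (n + 1)).splice (hip (n + 1)) (hsurj n) (s n) (hs n)
  let e (n : ℕ) := TensorProduct.prodLeft R R (F' (n + 1)) (P n) C
  refine ⟨fun n => .of R (LinearMap.ker (p n ∘ₗ (b n).rTensor C)),
    ⟨fun n => .of R (F' (n + 1) × P n), fun n => (e n).symm.toLinearMap ∘ₗ f n,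
      fun n => g n ∘ₗ (e n).toLinearMap, fun n => ⟨(e n).symm.injective.comp (hfg n).inj,
        (hfg n).surj.comp (e n).surjective, fun y => ?_⟩, fun n => ?_, fun n => ?_,
      fun n I J hI hJ k => ?_⟩, ?_⟩
  · simp [(hfg n).exact (e n y), LinearEquiv.symm_apply_eq]
  · have := hF' (n + 1)
    have := hP n
    exact IsShortExact.flat_mid (f := LinearMap.inl R (F' (n + 1)) (P n)) (g := LinearMap.snd R _ _)
      ⟨LinearMap.inl_injective, LinearMap.snd_surjective, Function.Exact.inl_snd⟩
  · exact ((hpd (n + 1)).syzygy (hab (n + 1)) (hP _)).prod (hP n)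
  · have := hF n
    obtain ⟨l, hl⟩ := (hq n).exists_extension_ker_comp (hip n)
      (HomHomExtends.rTensor (hab n) I J hI hJ) (hext n I J hI hJ) k
    refine ⟨l ∘ₗ LinearMap.snd R _ _ ∘ₗ (e n).toLinearMap, LinearMap.ext fun x => ?_⟩
    simpa [hf] using LinearMap.congr_fun hl x
  · obtain ⟨f, g, hfg, -⟩ := (hq 0).ker_comp (hip 0)
    exact ⟨.of R (F' 0 ⊗[R] C), f, g, hfg, F' 0, hF' 0, ⟨LinearEquiv.refl R _⟩⟩

theorem HasCoresolution.exists_projective (hC : IsSemidualizing R C) {k : ℕ}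
    {M : ℕ → ModuleCat.{u} R} (h : HasCoresolution C (PdLE k) M) :
    ∃ X : ℕ → ModuleCat.{u} R, HasCoresolution C (fun P => Module.Projective R P) X ∧
      ∃ (K : ModuleCat.{u} R) (f : K →ₗ[R] X 0) (g : X 0 →ₗ[R] M 0),
        IsShortExact f g ∧ IsCFlat R C K := by
  induction k generalizing M with
  | zero =>
    obtain ⟨F, i, p, hip, hF, hpd, hext⟩ := h
    refine ⟨M, ⟨F, i, p, hip, hF, fun n => (hpd n).projective (hF n), hext⟩,
      .of R (PUnit.{u + 1} ⊗[R] C), 0, LinearMap.id, ⟨fun _ _ _ => ?_, Function.surjective_id,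
        fun y => by simp [eq_comm]⟩, .of R PUnit.{u + 1}, ?_, ⟨LinearEquiv.refl R _⟩⟩
    · exact Subsingleton.elim (α := PUnit.{u + 1} ⊗[R] C) _ _
    · exact Module.Flat.of_projective (M := PUnit.{u + 1})
  | succ k ih =>
    obtain ⟨X, hX, K, f, g, hfg, hK⟩ := h.reduce hC
    obtain ⟨X', hX', K', f', g', hfg', hK'⟩ := ih hX
    obtain ⟨s, t, hst, -⟩ := hfg'.ker_comp hfg
    exact ⟨X', hX', .of R (LinearMap.ker (g ∘ₗ g')), Submodule.subtype _, g ∘ₗ g',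
      .of_ker _ (hfg.surj.comp hfg'.surj),
      IsShortExact.isCFlat_mid (B := .of R (LinearMap.ker (g ∘ₗ g'))) hC hst hK' hK⟩

end

section
variable {R : Type u} [CommRing R]

namespace ZComplex

section cycles

variable (Z : ZComplex R)

/-- The cokernel of the differential arriving in degree `i`. -/
abbrev coker (i : ℤ) : ModuleCat.{u} R := .of R (Z.X i ⧸ LinearMap.range (Z.d i))

/-- The map induced by the differential `d i` on the cokernel of `d (i + 1)`. -/
def cokerDesc (i : ℤ) : Z.coker (i + 1) →ₗ[R] Z.X i :=
  (LinearMap.range (Z.d (i + 1))).liftQ (Z.d i)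
    (LinearMap.range_le_ker_iff.mpr (Z.d_comp_d i))

variable {Z}

theorem IsExact.isShortExact (h : Z.IsExact) (i : ℤ) :
    IsShortExact (Z.cokerDesc i) (LinearMap.range (Z.d i)).mkQ := by
  refine ⟨?_, Submodule.mkQ_surjective _, ?_⟩
  · rw [← LinearMap.ker_eq_bot]
    exact Submodule.ker_liftQ_eq_bot _ _ _ (LinearMap.exact_iff.mp (h i)).le
  · rw [LinearMap.exact_iff, Submodule.ker_mkQ]
    exact (Submodule.range_liftQ _ _ _).symm

theorem TensorExact.rTensor_cokerDesc_injective {J : ModuleCat.{u} R} (h : Z.TensorExact J)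
    (i : ℤ) : Function.Injective ((Z.cokerDesc i).rTensor J) := by
  rw [injective_iff_map_eq_zero]
  intro x hx
  obtain ⟨y, rfl⟩ := LinearMap.rTensor_surjective J
    (Submodule.mkQ_surjective (LinearMap.range (Z.d (i + 1)))) x
  obtain ⟨z, rfl⟩ := (h i y).mp (by
    rw [← LinearMap.comp_apply, ← LinearMap.rTensor_comp] at hx
    exact hx)
  rw [← LinearMap.comp_apply, ← LinearMap.rTensor_comp, LinearMap.range_mkQ_comp,
    LinearMap.rTensor_zero, LinearMap.zero_apply]

end cycles

end ZComplex

variable [IsNoetherianRing R] {C : ModuleCat.{u} R}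

theorem IsGCFlat.exists_hasCoresolution (hdim : ringKrullDim R < ⊤) {M : ModuleCat.{u} R}
    (hM : IsGCFlat R C M) :
    ∃ (k : ℕ) (N : ℕ → ModuleCat.{u} R), HasCoresolution C (PdLE k) N ∧
      Nonempty (M ≃ₗ[R] N 0) ∧ ∀ I J : ModuleCat.{u} R, Module.Injective R I →
        Module.Injective R J → ExtVanish (N 0) (.of R ((C →ₗ[R] I) →ₗ[R] J)) := by
  obtain ⟨Z, hZ, hflat, hCflat, htensor, ⟨e⟩⟩ := hM
  obtain ⟨k, hk⟩ := exists_forall_pdLE hdim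
  have hext (i : ℤ) : HomHomExtends C (Z.cokerDesc i) :=
    .of_rTensor _ fun J hJ => (htensor J hJ).rTensor_cokerDesc_injective i
  let j : ℕ → ℤ
    | 0 => 0
    | n + 1 => Int.negSucc n
  have main (n : ℕ) : ∃ (F : ModuleCat.{u} R) (f : Z.coker (Int.negSucc n + 1) →ₗ[R] F ⊗[R] C)
      (p : F ⊗[R] C →ₗ[R] Z.coker (Int.negSucc n)), IsShortExact f p ∧ Module.Flat R F ∧
      PdLE k F ∧ HomHomExtends C f := by
    obtain ⟨F, hF, ⟨e⟩⟩ := hCflat (Int.negSucc n) (Int.negSucc_lt_zero n)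
    have h := hZ.isShortExact (Int.negSucc n)
    refine ⟨F, e.toLinearMap ∘ₗ Z.cokerDesc _, Submodule.mkQ _ ∘ₗ e.symm.toLinearMap,
      ⟨e.injective.comp h.inj, h.surj.comp e.symm.surjective, fun y => ?_⟩, hF, hk F hF,
      fun I J hI hJ l => ?_⟩
    · refine (h.exact (e.symm y)).trans ?_
      simp [Set.mem_range, LinearEquiv.eq_symm_apply]
    · obtain ⟨l', rfl⟩ := hext _ I J hI hJ l
      exact ⟨l' ∘ₗ e.symm.toLinearMap, LinearMap.ext fun x => by simp⟩
  have main' (n : ℕ) : ∃ (F : ModuleCat.{u} R) (f : Z.coker (j n) →ₗ[R] F ⊗[R] C)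
      (p : F ⊗[R] C →ₗ[R] Z.coker (j (n + 1))), IsShortExact f p ∧ Module.Flat R F ∧
      PdLE k F ∧ HomHomExtends C f := by
    cases n with
    | zero => exact main 0
    | succ n => exact main (n + 1)
  choose F f p h hF hpd hf using main'
  refine ⟨k, fun n => Z.coker (j n), ⟨F, f, p, h, hF, hpd, hf⟩, ⟨e⟩, fun I J hI hJ => ?_⟩
  exact ExtVanish.of_resolution (V := .of R ((C →ₗ[R] I) →ₗ[R] J)) (fun n => Z.coker n) (fun n => Z.X n) (fun n => Z.cokerDesc n)
    (fun n => (LinearMap.range (Z.d n)).mkQ) (fun n => hZ.isShortExact n)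
    (fun n => ExtVanish.of_flat_hom (.of R (C →ₗ[R] I)) J hJ _ (hflat n (Int.natCast_nonneg n)))
    (fun n => hext n I J hI hJ) 0

end

section
variable {R : Type u} [CommRing R]

namespace ZComplex

theorem homToExact_iff {Z : ZComplex R} {V : ModuleCat.{u} R} :
    Z.HomToExact V ↔ ∀ (i : ℤ) (k : Z.X (i + 1) →ₗ[R] V), k ∘ₗ Z.d (i + 1) = 0 →
      ∃ l : Z.X i →ₗ[R] V, l ∘ₗ Z.d i = k := by
  refine ⟨fun h i k hk => (h i k).mp hk, fun h i k => ⟨h i k, ?_⟩⟩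
  rintro ⟨l, rfl⟩
  change (l ∘ₗ Z.d i) ∘ₗ Z.d (i + 1) = 0
  rw [LinearMap.comp_assoc, Z.d_comp_d, LinearMap.comp_zero]

theorem HomToExact.of_equiv {Z : ZComplex R} {V W : ModuleCat.{u} R} (h : Z.HomToExact V)
    (e : V ≃ₗ[R] W) : Z.HomToExact W := by
  rw [homToExact_iff] at h ⊢
  intro i k hk
  obtain ⟨l, hl⟩ := h i (e.symm.toLinearMap ∘ₗ k) (by
    rw [LinearMap.comp_assoc, hk, LinearMap.comp_zero])
  refine ⟨e.toLinearMap ∘ₗ l, ?_⟩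
  rw [LinearMap.comp_assoc, hl]
  exact LinearMap.ext fun x => e.apply_symm_apply _

theorem HomToExact.pi {Z : ZComplex R} {ι : Type u} {V : ι → ModuleCat.{u} R}
    (h : ∀ p, Z.HomToExact (V p)) : Z.HomToExact (.of R (∀ p, V p)) := by
  simp only [homToExact_iff] at h ⊢
  intro i (k : Z.X (i + 1) →ₗ[R] ∀ p, V p) hk
  choose l hl using fun p => h p i (LinearMap.proj p ∘ₗ k) (by
    rw [LinearMap.comp_assoc]
    exact (congrArg _ hk).trans (LinearMap.comp_zero _))
  exact ⟨LinearMap.pi l, LinearMap.ext fun x => funext fun p => LinearMap.congr_fun (hl p) x⟩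

/-- If `0 → A → B → D → 0` is exact, `Hom(Z, B)` and `Hom(Z, D)` are exact and maps `Z i → D` lift
to `B`, then `Hom(Z, A)` is exact. -/
theorem HomToExact.left {Z : ZComplex R} {A B D : ModuleCat.{u} R} {f : A →ₗ[R] B}
    {g : B →ₗ[R] D} (h : IsShortExact f g) (hB : Z.HomToExact B) (hD : Z.HomToExact D)
    (hlift : ∀ (i : ℤ) (k : Z.X i →ₗ[R] D), ∃ l : Z.X i →ₗ[R] B, g ∘ₗ l = k) :
    Z.HomToExact A := by
  rw [homToExact_iff] at hB hD ⊢
  intro i k hk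
  obtain ⟨i, rfl⟩ : ∃ j : ℤ, i = j + 1 := ⟨i - 1, by omega⟩
  obtain ⟨l, hl⟩ := hB _ (f ∘ₗ k) (by rw [LinearMap.comp_assoc, hk, LinearMap.comp_zero])
  obtain ⟨m, hm⟩ := hD _ (g ∘ₗ l) (by
    rw [LinearMap.comp_assoc, hl, ← LinearMap.comp_assoc, h.exact.linearMap_comp_eq_zero,
      LinearMap.zero_comp])
  obtain ⟨m, rfl⟩ := hlift _ m
  have hr (x) : (l - m ∘ₗ Z.d i) x ∈ LinearMap.range f := (h.exact _).mp (by
    have := LinearMap.congr_fun hm x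
    simp only [LinearMap.comp_apply] at this
    simp [this])
  let e := LinearEquiv.ofInjective f h.inj
  refine ⟨e.symm.toLinearMap ∘ₗ (l - m ∘ₗ Z.d i).codRestrict _ hr, LinearMap.ext fun x => ?_⟩
  apply h.inj
  refine (congrArg Subtype.val (e.apply_symm_apply
    ((l - m ∘ₗ Z.d i).codRestrict _ hr (Z.d (i + 1) x)))).trans ?_
  have h₁ := LinearMap.congr_fun hl x
  have h₂ := LinearMap.congr_fun (Z.d_comp_d i) x
  simp only [LinearMap.comp_apply, LinearMap.zero_apply] at h₁ h₂
  simp [h₁, h₂]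

section ofShortExact

variable {A B : ℤ → ModuleCat.{u} R} (f : ∀ i, A (i + 1) →ₗ[R] B i) (g : ∀ i, B i →ₗ[R] A i)
  (h : ∀ i, IsShortExact (f i) (g i))

/-- The complex spliced from short exact sequences `0 → A (i + 1) → B i → A i → 0`. -/
def ofShortExact : ZComplex R where
  X := B
  d i := f i ∘ₗ g (i + 1)
  d_comp_d i := LinearMap.ext fun x => by
    simp [(h (i + 1)).exact.apply_apply_eq_zero]

theorem ofShortExact_isExact : (ofShortExact f g h).IsExact := fun i x => by
  change f i (g (i + 1) x) = 0 ↔ x ∈ Set.range fun y => f (i + 1) (g (i + 1 + 1) y)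
  rw [map_eq_zero_iff _ (h i).inj, (h (i + 1)).exact x]
  exact ⟨fun ⟨y, hy⟩ => let ⟨z, hz⟩ := (h (i + 1 + 1)).surj y
    ⟨z, (congrArg _ hz).trans hy⟩, fun ⟨z, hz⟩ => ⟨_, hz⟩⟩

theorem ofShortExact_homToExact {V : ModuleCat.{u} R}
    (hV : ∀ (i : ℤ) (k : A (i + 1) →ₗ[R] V), ∃ l : B i →ₗ[R] V, l ∘ₗ f i = k) :
    (ofShortExact f g h).HomToExact V := by
  rw [homToExact_iff]
  intro i (k : B (i + 1) →ₗ[R] V) (hk : k ∘ₗ f (i + 1) ∘ₗ g (i + 1 + 1) = 0)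
  have hker : LinearMap.ker (g (i + 1)) ≤ LinearMap.ker k := fun x hx => by
    obtain ⟨y, rfl⟩ := ((h (i + 1)).exact x).mp hx
    obtain ⟨z, rfl⟩ := (h (i + 1 + 1)).surj y
    exact LinearMap.congr_fun hk z
  obtain ⟨m, rfl⟩ := (g (i + 1)).exists_comp_eq_of_surjective (h (i + 1)).surj k hker
  obtain ⟨l, rfl⟩ := hV i m
  exact ⟨l, rfl⟩

theorem ofShortExact_isCokerOfD1 : (ofShortExact f g h).IsCokerOfD1 (A 0) := by
  have : LinearMap.range (f 0 ∘ₗ g (0 + 1)) = LinearMap.ker (g 0) := by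
    rw [LinearMap.range_comp_of_range_eq_top _ (LinearMap.range_eq_top.mpr (h (0 + 1)).surj),
      (LinearMap.exact_iff.mp (h 0).exact)]
  exact ⟨((Submodule.quotEquivOfEq _ _ this).trans
    ((g 0).quotKerEquivOfSurjective (h 0).surj)).symm⟩

end ofShortExact

theorem HomToExact.tensor_of_flat [IsNoetherianRing R] {C : ModuleCat.{u} R} {Z : ZComplex R}
    [Module.Finite R C] (hdim : ringKrullDim R < ⊤) (hC : Function.Bijective (LinearMap.lsmul R C))
    (hproj : ∀ i, Module.Projective R (Z.X i) ∨ IsCProjective R C (Z.X i))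
    (hexact : ∀ I J : ModuleCat.{u} R, Module.Injective R I → Module.Injective R J →
      Z.HomToExact (.of R ((C →ₗ[R] I) →ₗ[R] J)))
    (G : ModuleCat.{u} R) (hG : Module.Flat R G) : Z.HomToExact (.of R (G ⊗[R] C)) := by
  obtain ⟨N, hN⟩ := Module.Flat.coresolution_induction hdim
    (P := fun _ G => Z.HomToExact (.of R (G ⊗[R] C)))
    (fun G hG => by
      rw [homToExact_iff]
      have : Subsingleton (G ⊗[R] C) := inferInstance
      exact fun i k _ => ⟨0, LinearMap.ext fun x => Subsingleton.elim (α := G ⊗[R] C) _ _⟩)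
    (fun n G G' ι E J f g hE hJ hf hg hfg hG hT hG' ih => by
      have h : IsShortExact f g := ⟨hf, hg, hfg⟩
      refine HomToExact.left (B := .of R ((∀ p, E p →ₗ[R] J p) ⊗[R] C)) (h.rTensor C) ?_ ih ?_
      · let e := LinearEquiv.ofBijective _
          (homEval_bijective R (fun p => E p) (fun p => J p) hJ C)
        exact (HomToExact.pi fun p => hexact (E p) (J p) (hE p) (hJ p)).of_equiv
          (W := .of R ((∀ p, E p →ₗ[R] J p) ⊗[R] C))
          (e.symm.trans (TensorProduct.comm R _ _))
      · intro i (k : Z.X i →ₗ[R] G' ⊗[R] C)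
        rcases hproj i with hP | ⟨P, hP, ⟨e⟩⟩
        · exact Module.projective_lifting_property _ k (h.rTensor C).surj
        · obtain ⟨l, hl⟩ := exists_rTensor_comp_eq hC g hg (k ∘ₗ e.symm.toLinearMap)
          refine ⟨l ∘ₗ e.toLinearMap, ?_⟩
          rw [← LinearMap.comp_assoc]
          exact (congrArg (· ∘ₗ e.toLinearMap) hl).trans
            (LinearMap.ext fun x => by simp))
  exact hN G hG

end ZComplex

end

section
variable {R : Type u} [CommRing R] [IsNoetherianRing R] {C : ModuleCat.{u} R}

theorem ExtVanish.of_equiv {R : Type u} [CommRing R] {A B V : ModuleCat.{u} R}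
    (h : ExtVanish A V) (e : A ≃ₗ[R] B) : ExtVanish B V := by
  refine IsShortExact.extVanish_mid (f := e.toLinearMap)
    (g := (0 : B →ₗ[R] ModuleCat.of R PUnit.{u + 1})) ⟨e.injective, fun _ => ⟨0, rfl⟩, ?_⟩ h
    .of_projective
  exact fun b => ⟨fun _ => e.surjective b, fun _ => rfl⟩

theorem HasCoresolution.isGCProjective (hdim : ringKrullDim R < ⊤) (hC : IsSemidualizing R C)
    {X : ℕ → ModuleCat.{u} R} (hX : HasCoresolution C (fun P => Module.Projective R P) X)
    (hext : ∀ I J : ModuleCat.{u} R, Module.Injective R I → Module.Injective R J →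
      ExtVanish (X 0) (.of R ((C →ₗ[R] I) →ₗ[R] J))) : IsGCProjective R C (X 0) := by
  obtain ⟨P, i, p, hip, -, hP, hi⟩ := hX
  obtain ⟨S, Q, s, q, hS, hsq, hvan, hQ⟩ := exists_resolution
    (Q := fun A => ∀ I J : ModuleCat.{u} R, Module.Injective R I → Module.Injective R J →
      ExtVanish A (.of R ((C →ₗ[R] I) →ₗ[R] J)))
    (T := fun B => Module.Projective R B)
    (fun A hA => by
      obtain ⟨A', B, f, g, h, hB⟩ := exists_projective_presentation A
      exact ⟨A', B, f, g, h, fun I J hI hJ => h.extVanish_left .of_projective (hA I J hI hJ), hB⟩)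
    (X 0) hext
  let A : ℤ → ModuleCat.{u} R
    | Int.ofNat n => S n
    | Int.negSucc n => X (n + 1)
  have main (m : ℤ) : ∃ (B : ModuleCat.{u} R) (f : A (m + 1) →ₗ[R] B) (g : B →ₗ[R] A m),
      IsShortExact f g ∧ HomHomExtends C f ∧ (0 ≤ m → Module.Projective R B) ∧
      (m < 0 → IsCProjective R C B) := by
    rcases m with n | n | n
    · exact ⟨Q n, s n, q n, hsq n, fun I J hI hJ =>
        haveI := hvan n I J hI hJ 0
        (hsq n).exists_extension (V := .of R ((C →ₗ[R] I) →ₗ[R] J)), fun _ => hQ n,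
        fun h => absurd h (by simp)⟩
    · obtain ⟨f, hf, hf'⟩ :
          ∃ f : S 0 →ₗ[R] P 0 ⊗[R] C, IsShortExact f (p 0) ∧ HomHomExtends C f := by
        rw [hS]
        exact ⟨i 0, hip 0, hi 0⟩
      exact ⟨.of R (P 0 ⊗[R] C), f, p 0, hf, hf', fun h => absurd h (by decide),
        fun _ => ⟨P 0, hP 0, ⟨LinearEquiv.refl R _⟩⟩⟩
    · exact ⟨.of R (P (n + 1) ⊗[R] C), i (n + 1), p (n + 1), hip (n + 1), hi (n + 1),
        fun h => absurd h (by simp), fun _ => ⟨P (n + 1), hP (n + 1), ⟨LinearEquiv.refl R _⟩⟩⟩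
  choose B f g h hf hB hB' using main
  have := hC.1
  have hcoker := ZComplex.ofShortExact_isCokerOfD1 f g h
  change ZComplex.IsCokerOfD1 _ (S 0) at hcoker
  rw [hS] at hcoker
  refine ⟨.ofShortExact f g h, ZComplex.ofShortExact_isExact f g h, hB, hB', fun V hV => ?_, hcoker⟩
  obtain ⟨G, hG, ⟨e⟩⟩ := hV
  refine (ZComplex.HomToExact.tensor_of_flat hdim hC.2.1 (fun m => ?_) (fun I J hI hJ => ?_) G
    inferInstance).of_equiv e.symm
  · exact (le_or_gt 0 m).imp (hB m) (hB' m)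
  · exact ZComplex.ofShortExact_homToExact (V := .of R ((C →ₗ[R] I) →ₗ[R] J)) f g h
      fun m => hf m I J hI hJ

theorem IsGCFlat.exists_shortExact (hdim : ringKrullDim R < ⊤) (hC : IsSemidualizing R C)
    {M : ModuleCat.{u} R} (hM : IsGCFlat R C M) :
    ∃ (K X : ModuleCat.{u} R) (f : K →ₗ[R] X) (g : X →ₗ[R] M),
      IsShortExact f g ∧ IsCFlat R C K ∧ IsGCProjective R C X := by
  obtain ⟨k, N, hN, ⟨e⟩, hvan⟩ := hM.exists_hasCoresolution hdim
  obtain ⟨X, hX, K, f, g, hfg, hK⟩ := hN.exists_projective hC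
  refine ⟨K, X 0, f, e.symm.toLinearMap ∘ₗ g, ⟨hfg.inj, e.symm.surjective.comp hfg.surj,
    fun x => by simp [hfg.exact x]⟩, hK, hX.isGCProjective hdim hC fun I J hI hJ => ?_⟩
  obtain ⟨L, hL, ⟨e'⟩⟩ := hK
  exact hfg.extVanish_mid ((hC.extVanish_hom_hom L I J hI hJ).of_equiv e'.symm) (hvan I J hI hJ)

end

/-- If `R` has finite Krull dimension and `M` is `G_C`-flat, then there
is a short exact sequence `0 → K → X → M → 0` with `K` `C`-flat and `X` `G_C`-projective. -/
theorem stmt8 (R : Type u) [CommRing R] [IsNoetherianRing R]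
    (hdim : ringKrullDim R < ⊤)
    (C : ModuleCat.{u} R) (hC : IsSemidualizing R C) (M : ModuleCat.{u} R)
    (hM : IsGCFlat R C M) :
    ∃ (K X : ModuleCat.{u} R) (f : ↥K →ₗ[R] ↥X) (g : ↥X →ₗ[R] ↥M),
      Function.Injective f ∧ Function.Surjective g ∧ Function.Exact f g ∧
      IsCFlat R C K ∧ IsGCProjective R C X := by
  obtain ⟨K, X, f, g, h, hK, hX⟩ := hM.exists_shortExact hdim hC
  exact ⟨K, X, f, g, h.inj, h.surj, h.exact, hK, hX⟩
end

section
/- Let R be a commutative noetherian ring, C a semidualizing R-module, and M an R-module. The Pontryagin dual M* = Hom_ℤ(M, ℚ/ℤ) is C-flat if and only if M is C-injective. -/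
open CategoryTheory TensorProduct

universe u

open CharacterModule

section

variable {R : Type*} [CommRing R]
variable {A A' B C F N P : Type*} [AddCommGroup A] [AddCommGroup A'] [AddCommGroup B]
  [AddCommGroup C] [AddCommGroup F] [AddCommGroup N] [AddCommGroup P]
  [Module R A] [Module R A'] [Module R B] [Module R C] [Module R F] [Module R N] [Module R P]

/-- Passing to character modules preserves exactness. -/
lemma CharacterModule.dual_exact {f : A →ₗ[R] A'} {g : A' →ₗ[R] B} (h : Function.Exact f g) :
    Function.Exact (dual g) (dual f) := by
  intro c
  constructor
  · intro hc
    have hker : ∀ x ∈ g.toAddMonoidHom.ker, c x = 0 := by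
      intro x hx
      obtain ⟨y, rfl⟩ := (h x).mp hx
      exact DFunLike.congr_fun hc y
    obtain ⟨L, hL⟩ := dual_surjective_of_injective
      (QuotientAddGroup.kerLift g.toAddMonoidHom).toIntLinearMap
      (QuotientAddGroup.kerLift_injective g.toAddMonoidHom)
      (QuotientAddGroup.lift g.toAddMonoidHom.ker c hker)
    refine ⟨L, ?_⟩
    ext x
    exact DFunLike.congr_fun hL (QuotientAddGroup.mk x)
  · rintro ⟨L, rfl⟩
    ext x
    change L (g (f x)) = 0
    rw [h.apply_apply_eq_zero, map_zero]

variable (R C N) in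
/-- The evaluation map `C ⊗ N⋆ → Hom(C, N)⋆`, sending `c ⊗ φ` to `f ↦ φ (f c)`. -/
noncomputable def tensorDualToDualHom :
    C ⊗[R] CharacterModule N →ₗ[R] CharacterModule (C →ₗ[R] N) :=
  TensorProduct.lift
    { toFun := fun c ↦ dual (LinearMap.applyₗ c)
      map_add' := fun c c' ↦ by
        ext φ f
        change φ (f (c + c')) = φ (f c) + φ (f c')
        simp
      map_smul' := fun r c ↦ by
        ext φ f
        change φ (f (r • c)) = φ ((r • f) c)
        simp }

lemma tensorDualToDualHom_naturality (g : A →ₗ[R] B) :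
    dual (LinearMap.lcomp R N g) ∘ₗ tensorDualToDualHom R A N =
      tensorDualToDualHom R B N ∘ₗ g.rTensor (CharacterModule N) :=
  TensorProduct.ext' fun _ _ ↦ rfl

lemma tensorDualToDualHom_bijective_pi (n : ℕ) :
    Function.Bijective (tensorDualToDualHom R (Fin n → R) N) := by
  let e (i : Fin n) : N →ₗ[R] (Fin n → R) →ₗ[R] N :=
    LinearMap.smulRightₗ (LinearMap.proj i)
  let inv (ψ : CharacterModule ((Fin n → R) →ₗ[R] N)) :
      (Fin n → R) ⊗[R] CharacterModule N :=
    ∑ i, Pi.single i 1 ⊗ₜ dual (e i) ψ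
  refine Function.bijective_iff_has_inverse.mpr ⟨inv, fun x ↦ ?_, fun ψ ↦ ?_⟩
  · induction x with
    | zero => simp only [inv, map_zero, TensorProduct.tmul_zero, Finset.sum_const_zero]
    | add x y hx hy =>
      simp only [inv, map_add, TensorProduct.tmul_add, Finset.sum_add_distrib] at hx hy ⊢
      rw [hx, hy]
    | tmul v φ =>
      have key (i : Fin n) : dual (e i) (tensorDualToDualHom R _ N (v ⊗ₜ φ)) = v i • φ := rfl
      simp only [inv, key, ← TensorProduct.smul_tmul, ← TensorProduct.sum_tmul]
      congr 1
      exact (pi_eq_sum_univ' v).symm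
  · ext f
    have key (i : Fin n) : tensorDualToDualHom R _ N (Pi.single i 1 ⊗ₜ dual (e i) ψ) f =
      ψ (e i (f (Pi.single i 1))) := rfl
    have hf : ∑ i, e i (f (Pi.single i 1)) = f := by
      ext i
      simp [e, Pi.single_apply]
    conv_rhs => rw [← hf, map_sum]
    simp only [inv, map_sum, ← key]
    exact AddMonoidHom.finsetSum_apply _ _ _

/-- For finitely presented `C`, the evaluation map `C ⊗ N⋆ → Hom(C, N)⋆` is bijective. -/
lemma tensorDualToDualHom_bijective [Module.FinitePresentation R C] :
    Function.Bijective (tensorDualToDualHom R C N) := by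
  obtain ⟨n, m, f, g, hf, hgf⟩ := Module.FinitePresentation.exists_fin' R C
  exact LinearMap.bijective_of_surjective_of_bijective_of_right_exact
    (g.rTensor (CharacterModule N)) (f.rTensor (CharacterModule N))
    (dual (LinearMap.lcomp R N g)) (dual (LinearMap.lcomp R N f)) _ _ _
    (tensorDualToDualHom_naturality g) (tensorDualToDualHom_naturality f)
    (rTensor_exact _ hgf hf)
    (dual_exact (LinearMap.exact_lcomp_of_exact_of_surjective _ hgf hf))
    (tensorDualToDualHom_bijective_pi m).2 (tensorDualToDualHom_bijective_pi n)
    (LinearMap.rTensor_surjective _ hf)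
    (dual_surjective_of_injective _ (LinearMap.lcomp_injective_of_surjective f hf))

/-- For finitely presented `C` and flat `F`, the map `F ⊗ Hom(C, P) → Hom(C, F ⊗ P)` is
bijective. -/
lemma lTensorHomToHomLTensor_bijective_s9 [Module.FinitePresentation R C] [Module.Flat R F] :
    Function.Bijective (lTensorHomToHomLTensor (.id R) C F P) := by
  obtain ⟨n, m, f, g, hf, hgf⟩ := Module.FinitePresentation.exists_fin' R C
  have free (k : ℕ) : Function.Bijective (lTensorHomToHomLTensor (.id R) (Fin k → R) F P) := by
    rw [← lTensorHomEquivHomLTensor_toLinearMap]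
    exact (lTensorHomEquivHomLTensor R (Fin k → R) F P).bijective
  refine LinearMap.bijective_of_bijective_of_injective_of_left_exact
    ((LinearMap.lcomp R P f).lTensor F) ((LinearMap.lcomp R P g).lTensor F)
    (LinearMap.lcomp R (F ⊗[R] P) f) (LinearMap.lcomp R (F ⊗[R] P) g) _ _ _
    (TensorProduct.ext' fun _ _ ↦ rfl) (TensorProduct.ext' fun _ _ ↦ rfl)
    (Module.Flat.lTensor_exact F (LinearMap.exact_lcomp_of_exact_of_surjective _ hgf hf))
    (LinearMap.exact_lcomp_of_exact_of_surjective _ hgf hf)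
    (free n) (free m).1
    (Module.Flat.lTensor_preserves_injective_linearMap _
      (LinearMap.lcomp_injective_of_surjective f hf))
    (LinearMap.lcomp_injective_of_surjective f hf)

end

/-- Over a noetherian ring, `N` is injective if and only if its character module is flat. -/
lemma flat_characterModule_iff_injective {R : Type u} [CommRing R] [IsNoetherianRing R]
    {N : Type u} [AddCommGroup N] [Module R N] :
    Module.Flat R (CharacterModule N) ↔ Module.Injective R N := by
  rw [← Module.Baer.iff_injective, Module.Baer.iff_surjective,
    Module.Flat.iff_rTensor_injective']
  refine forall_congr' fun I ↦ ?_
  have hI : Module.FinitePresentation R I := Module.finitePresentation_of_finite R I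
  rw [← dual_injective_iff_surjective,
    ← Function.Injective.of_comp_iff (tensorDualToDualHom_bijective (C := R) (N := N)).1,
    ← Function.Injective.of_comp_iff' _ (tensorDualToDualHom_bijective (C := I) (N := N)),
    ← LinearMap.coe_comp, ← LinearMap.coe_comp, tensorDualToDualHom_naturality]

section

variable {R : Type*} [CommRing R] {C F M : Type*} [AddCommGroup C] [AddCommGroup F]
  [AddCommGroup M] [Module R C] [Module R F] [Module R M]

/-- If the homothety map of the finitely presented module `C` is bijective and `F` is flat, then
`x ↦ (c ↦ x ⊗ c)` is an isomorphism `F ≃ Hom(C, F ⊗ C)`. -/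
lemma mk_bijective_of_lsmul_bijective [Module.FinitePresentation R C] [Module.Flat R F]
    (hC : Function.Bijective (LinearMap.lsmul R C)) :
    Function.Bijective (TensorProduct.mk R F C) := by
  let e : F ≃ₗ[R] C →ₗ[R] F ⊗[R] C :=
    (TensorProduct.rid R F).symm ≪≫ₗ
      (LinearEquiv.ofBijective (LinearMap.lsmul R C) hC).lTensor F ≪≫ₗ
      LinearEquiv.ofBijective _ lTensorHomToHomLTensor_bijective_s9
  have he : TensorProduct.mk R F C = e.toLinearMap := by
    ext x c
    simp [e]
  rw [he]
  exact e.bijective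

/-- If `M⋆ ≃ F ⊗ C` with `F` flat, then `F ≃ (C ⊗ M)⋆`. -/
noncomputable def equivDualTensor [Module.FinitePresentation R C] [Module.Flat R F]
    (hC : Function.Bijective (LinearMap.lsmul R C)) (e : CharacterModule M ≃ₗ[R] F ⊗[R] C) :
    F ≃ₗ[R] CharacterModule (C ⊗[R] M) :=
  LinearEquiv.ofBijective _ (mk_bijective_of_lsmul_bijective hC) ≪≫ₗ
    e.symm.congrRight ≪≫ₗ homEquiv

lemma equivDualTensor_apply_tmul [Module.FinitePresentation R C] [Module.Flat R F]
    (hC : Function.Bijective (LinearMap.lsmul R C)) (e : CharacterModule M ≃ₗ[R] F ⊗[R] C)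
    (x : F) (c : C) (m : M) :
    equivDualTensor hC e x (c ⊗ₜ m) = e.symm (x ⊗ₜ c) m := rfl

/-- If `M⋆ ≃ F ⊗ C` with `F` flat, then the unit map `M → Hom(C, C ⊗ M)` is bijective. -/
lemma mk_flip_bijective [Module.FinitePresentation R C] [Module.Flat R F]
    (hC : Function.Bijective (LinearMap.lsmul R C)) (e : CharacterModule M ≃ₗ[R] F ⊗[R] C) :
    Function.Bijective (TensorProduct.mk R C M).flip := by
  rw [← dual_bijective_iff_bijective]
  have h : dual (TensorProduct.mk R C M).flip ∘ₗ tensorDualToDualHom R C (C ⊗[R] M) ∘ₗ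
      ((equivDualTensor hC e).lTensor C).toLinearMap =
      (TensorProduct.comm R C F ≪≫ₗ e.symm).toLinearMap := by
    refine TensorProduct.ext' fun c x ↦ ?_
    ext m
    exact equivDualTensor_apply_tmul hC e x c m
  have hbij := (TensorProduct.comm R C F ≪≫ₗ e.symm).bijective
  rw [← LinearEquiv.coe_coe, ← h, LinearMap.coe_comp] at hbij
  refine (Function.Bijective.of_comp_iff _ ?_).mp hbij
  exact tensorDualToDualHom_bijective.comp ((equivDualTensor hC e).lTensor C).bijective

end

/-- The Pontryagin dual `M*` is `C`-flat iff `M` is `C`-injective. -/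
theorem stmt9 (R : Type u) [CommRing R] [IsNoetherianRing R]
    (C : ModuleCat.{u} R) (hC : IsSemidualizing R C) (M : ModuleCat.{u} R) :
    IsCFlat R C (ModuleCat.of R (CharacterModule ↥M)) ↔ IsCInjective R C M := by
  obtain ⟨hfin, hsmul, -⟩ := hC
  have hfp : Module.FinitePresentation R C := Module.finitePresentation_of_finite R C
  constructor
  · rintro ⟨F, hF, ⟨e⟩⟩
    exact ⟨ModuleCat.of R (C ⊗[R] M),
      flat_characterModule_iff_injective.mp (.of_linearEquiv (equivDualTensor hsmul e).symm),
      ⟨LinearEquiv.ofBijective _ (mk_flip_bijective hsmul e)⟩⟩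
  · rintro ⟨I, hI, ⟨e⟩⟩
    exact ⟨ModuleCat.of R (CharacterModule I), flat_characterModule_iff_injective.mpr hI,
      ⟨CharacterModule.congr e ≪≫ₗ
        (LinearEquiv.ofBijective _ (tensorDualToDualHom_bijective (C := C))).symm ≪≫ₗ
        TensorProduct.comm R _ _⟩⟩
end
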